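/- arXiv:1806.02236 — 2 statements merged into one kernel-verified Lean document; each statement's English description precedes it below -/
import Mathlib

section
/- Let P ⊆ ℝ³ be a 3-dimensional reflexive canonical lattice polytope. Then the normalized volume of P equals 2·|∂P ∩ ℤ³| − 4, where ∂P ∩ ℤ³ is the (finite) set of lattice points on the boundary of P. In particular the normalized volume of a 3-dimensional reflexive polytope is even; consequently every K3 polytope has an even number of vertices. -/
open Set MeasureTheory

noncomputable section

/-- Points of `ℝ³` with integer coordinates. -/
def latticePts : Set (Fin 3 → ℝ) := {x | ∀ i, ∃ n : ℤ, x i = (n : ℝ)}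

/-- The point `(1,1,1)`. -/
def pOne : Fin 3 → ℝ := ![1, 1, 1]

/-- The tetrahedron `4Δ₃ = conv{(0,0,0),(4,0,0),(0,4,0),(0,0,4)}`. -/
def Delta4 : Set (Fin 3 → ℝ) :=
  convexHull ℝ {![0, 0, 0], ![4, 0, 0], ![0, 4, 0], ![0, 0, 4]}

/-- A subpolytope of `4Δ₃`: a lattice polytope `P ⊆ 4Δ₃` with `P = conv(P ∩ ℤ³)`. -/
def IsSubpolytope (P : Set (Fin 3 → ℝ)) : Prop :=
  P ⊆ Delta4 ∧ P = convexHull ℝ (P ∩ latticePts)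

/-- A canonical subpolytope of `4Δ₃`: a subpolytope with `(1,1,1)` in its interior
(this forces it to be `3`-dimensional). -/
def IsCanonicalSub (P : Set (Fin 3 → ℝ)) : Prop :=
  IsSubpolytope P ∧ pOne ∈ interior P

/-- The standard inner product on `ℝⁿ`. -/
def dotp {n : ℕ} (a x : Fin n → ℝ) : ℝ := ∑ i, a i * x i

/-- Equivalence of subsets of `ℝ³` under the group of affine symmetries of `4Δ₃`. -/
def SymEquiv (P Q : Set (Fin 3 → ℝ)) : Prop :=
  ∃ g : (Fin 3 → ℝ) ≃ᵃ[ℝ] (Fin 3 → ℝ), g '' Delta4 = Delta4 ∧ g '' P = Q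

/-- `F` is a facet of `P`: an exposed face of dimension `2`. -/
def IsFacetOf (F P : Set (Fin 3 → ℝ)) : Prop :=
  ∃ (a : Fin 3 → ℝ) (b : ℝ),
    (∀ x ∈ P, b ≤ dotp a x) ∧ F = P ∩ {x | dotp a x = b} ∧
    Module.finrank ℝ (affineSpan ℝ F).direction = 2

/-- `P` (canonical, with interior lattice point `p`) is reflexive: every facet lies on an
integral hyperplane at lattice distance one from `p`. -/
def IsReflexive (P : Set (Fin 3 → ℝ)) (p : Fin 3 → ℝ) : Prop :=
  ∀ F, IsFacetOf F P →
    ∃ (a : Fin 3 → ℤ) (b : ℤ),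
      (∀ x ∈ F, dotp (fun i => (a i : ℝ)) x = (b : ℝ)) ∧
      (∀ x ∈ P, (b : ℝ) ≤ dotp (fun i => (a i : ℝ)) x) ∧
      dotp (fun i => (a i : ℝ)) p = (b : ℝ) + 1

/-- A canonical lattice polytope in `ℝ³` with interior lattice point `p`. -/
def IsCanonicalPoly (P : Set (Fin 3 → ℝ)) (p : Fin 3 → ℝ) : Prop :=
  (∃ F : Set (Fin 3 → ℝ), F.Finite ∧ F ⊆ latticePts ∧ P = convexHull ℝ F) ∧
  p ∈ latticePts ∧ interior P ∩ latticePts = {p}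

namespace LatticeCone

/-- The real vector underlying an integer vector. -/
def toReal {ι : Type*} (x : ι → ℤ) : ι → ℝ := fun i => (x i : ℝ)

theorem toReal_injective {ι : Type*} : Function.Injective (toReal : (ι → ℤ) → (ι → ℝ)) :=
    fun x y h => by
  ext i
  exact Int.cast_injective (α := ℝ) (congrFun h i)

@[simp] theorem toReal_add {ι : Type*} (x y : ι → ℤ) : toReal (x + y) = toReal x + toReal y := by
  ext; simp [toReal]

@[simp] theorem toReal_sub {ι : Type*} (x y : ι → ℤ) : toReal (x - y) = toReal x - toReal y := by
  ext; simp [toReal]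

@[simp] theorem toReal_zero {ι : Type*} : toReal (0 : ι → ℤ) = 0 := by
  ext; simp [toReal]

/-- The real matrix underlying an integer matrix. -/
def toRealMatrix {ι : Type*} (M : Matrix ι ι ℤ) : Matrix ι ι ℝ := M.map (fun z => (z : ℝ))

theorem toReal_vecMul {ι : Type*} [Fintype ι] (z : ι → ℤ) (M : Matrix ι ι ℤ) :
    toReal (Matrix.vecMul z M) = Matrix.vecMul (toReal z) (toRealMatrix M) := by
  ext i
  simp [toReal, toRealMatrix, Matrix.vecMul, dotProduct]

section Coordinates
variable {ι : Type*} [Fintype ι] [DecidableEq ι]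

/-- The coordinates of a vector with respect to the rows of `M`. -/
def coord (M : Matrix ι ι ℝ) : (ι → ℝ) →ₗ[ℝ] (ι → ℝ) := M⁻¹.vecMulLinear

theorem coord_vecMul {M : Matrix ι ι ℝ} (hM : M.det ≠ 0) (w : ι → ℝ) :
    coord M (Matrix.vecMul w M) = w := by
  simp [coord, Matrix.vecMul_vecMul, Matrix.mul_nonsing_inv M (isUnit_iff_ne_zero.2 hM)]

theorem vecMul_coord {M : Matrix ι ι ℝ} (hM : M.det ≠ 0) (y : ι → ℝ) :
    Matrix.vecMul (coord M y) M = y := by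
  simp [coord, Matrix.vecMul_vecMul, Matrix.nonsing_inv_mul M (isUnit_iff_ne_zero.2 hM)]

theorem sum_coord_smul {M : Matrix ι ι ℝ} (hM : M.det ≠ 0) (y : ι → ℝ) :
    ∑ i, coord M y i • M i = y := by
  rw [← Matrix.vecMul_eq_sum, vecMul_coord hM]

theorem coord_sum_smul {M : Matrix ι ι ℝ} (hM : M.det ≠ 0) (w : ι → ℝ) :
    coord M (∑ i, w i • M i) = w := by
  rw [← Matrix.vecMul_eq_sum, coord_vecMul hM]

theorem coord_row {M : Matrix ι ι ℝ} (hM : M.det ≠ 0) (i : ι) :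
    coord M (M i) = Pi.single i 1 := by
  conv_rhs => rw [← coord_vecMul hM (Pi.single i 1)]
  rw [Matrix.single_one_vecMul]
  rfl

theorem coord_injective {M : Matrix ι ι ℝ} (hM : M.det ≠ 0) : Function.Injective (coord M) :=
  fun x y h => by rw [← vecMul_coord hM x, h, vecMul_coord hM]

theorem det_coord (M : Matrix ι ι ℝ) : LinearMap.det (coord M) = M.det⁻¹ := by
  have : coord M = Matrix.toLin' (M⁻¹).transpose := by
    refine LinearMap.ext fun x => ?_
    simp [coord, Matrix.mulVec_transpose]
  rw [this, LinearMap.det_toLin', Matrix.det_transpose, Matrix.det_nonsing_inv,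
    Ring.inverse_eq_inv']

theorem det_toRealMatrix (M : Matrix ι ι ℤ) : (toRealMatrix M).det = (M.det : ℝ) := by
  have := (Int.castRingHom ℝ).map_det M
  simpa [toRealMatrix, RingHom.mapMatrix_apply] using this.symm

theorem det_toRealMatrix_ne_zero {M : Matrix ι ι ℤ} (hM : M.det ≠ 0) :
    (toRealMatrix M).det ≠ 0 := by
  rw [det_toRealMatrix]; exact_mod_cast hM

/-- Half-open parallelepiped spanned by the rows of `M`: coordinate `i` lies in `[0, 1)` if
`p i` holds and in `(0, 1]` otherwise. -/
def halfOpenBox (M : Matrix ι ι ℤ) (p : ι → Prop) : Set (ι → ℤ) :=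
  {x | ∀ i, (p i → 0 ≤ coord (toRealMatrix M) (toReal x) i ∧
      coord (toRealMatrix M) (toReal x) i < 1) ∧
    (¬ p i → 0 < coord (toRealMatrix M) (toReal x) i ∧
      coord (toRealMatrix M) (toReal x) i ≤ 1)}

theorem ncard_halfOpenBox {M : Matrix ι ι ℤ} (hM : M.det ≠ 0) (p : ι → Prop) :
    (halfOpenBox M p).ncard = M.det.natAbs := by
  classical
  have hR := det_toRealMatrix_ne_zero hM
  set L : (ι → ℤ) →ₗ[ℤ] (ι → ℤ) := M.vecMulLinear with hL
  have hLinj : Function.Injective L := fun x y h => by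
    have h' := congrArg toReal h
    rw [hL, Matrix.vecMulLinear_apply, Matrix.vecMulLinear_apply, toReal_vecMul,
      toReal_vecMul] at h'
    exact toReal_injective (by rw [← coord_vecMul hR (toReal x), h', coord_vecMul hR])
  have hdet : LinearMap.det L = M.det := by
    have : L = Matrix.toLin' M.transpose := by
      refine LinearMap.ext fun x => ?_
      simp [hL, Matrix.mulVec_transpose]
    rw [this, LinearMap.det_toLin', Matrix.det_transpose]
  have hcard := Submodule.natAbs_det_equiv L.range (LinearEquiv.ofInjective L hLinj)
  have hcomp : (L.range.subtype ∘ₗ AddMonoidHom.toIntLinearMap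
      ((LinearEquiv.ofInjective L hLinj : (ι → ℤ) ≃ₗ[ℤ] L.range) : (ι → ℤ) →+ L.range)) = L := by
    ext1 i; rfl
  rw [hcomp, hdet] at hcard
  rw [hcard, ← Nat.card_coe_set_eq]
  refine Nat.card_eq_of_bijective
    (fun x : halfOpenBox M p => (Submodule.Quotient.mk x.1 : (ι → ℤ) ⧸ L.range)) ⟨?_, ?_⟩
  · rintro ⟨x, hx⟩ ⟨y, hy⟩ h
    obtain ⟨z, hz⟩ := (Submodule.Quotient.eq L.range).1 h
    have hc : coord (toRealMatrix M) (toReal x) - coord (toRealMatrix M) (toReal y) = toReal z := by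
      rw [← map_sub, ← toReal_sub, ← hz, hL, Matrix.vecMulLinear_apply, toReal_vecMul,
        coord_vecMul hR]
    have hz0 : z = 0 := by
      ext i
      have h1 := congrFun hc i
      simp only [Pi.sub_apply, toReal] at h1
      have h2 := hx i
      have h3 := hy i
      have h4 : (-1 : ℝ) < z i ∧ (z i : ℝ) < 1 := by
        by_cases hp : p i
        · have := h2.1 hp; have := h3.1 hp
          constructor <;> linarith
        · have := h2.2 hp; have := h3.2 hp
          constructor <;> linarith
      have h5 : -1 < z i := by exact_mod_cast h4.1
      have h6 : z i < 1 := by exact_mod_cast h4.2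
      simp; omega
    rw [hz0, map_zero] at hz
    exact Subtype.ext (sub_eq_zero.1 hz.symm)
  · intro q
    obtain ⟨x, rfl⟩ := Submodule.Quotient.mk_surjective _ q
    let z : ι → ℤ := fun i => if p i then ⌊coord (toRealMatrix M) (toReal x) i⌋
      else ⌈coord (toRealMatrix M) (toReal x) i⌉ - 1
    have hc : coord (toRealMatrix M) (toReal (x - L z)) =
        coord (toRealMatrix M) (toReal x) - toReal z := by
      rw [toReal_sub, map_sub, hL, Matrix.vecMulLinear_apply, toReal_vecMul, coord_vecMul hR]
    refine ⟨⟨x - L z, fun i => ⟨fun hp => ?_, fun hp => ?_⟩⟩, ?_⟩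
    · rw [hc]
      simp only [Pi.sub_apply, toReal, z, if_pos hp]
      exact ⟨sub_nonneg.2 (Int.floor_le _), sub_lt_iff_lt_add'.2 (Int.lt_floor_add_one _)⟩
    · rw [hc]
      simp only [Pi.sub_apply, toReal, z, if_neg hp]
      push_cast
      exact ⟨by linarith [Int.ceil_lt_add_one (coord (toRealMatrix M) (toReal x) i)],
        by linarith [Int.le_ceil (coord (toRealMatrix M) (toReal x) i)]⟩
    · refine (Submodule.Quotient.eq L.range).2 ⟨-z, ?_⟩
      simp

theorem finite_halfOpenBox {M : Matrix ι ι ℤ} (hM : M.det ≠ 0) (p : ι → Prop) :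
    (halfOpenBox M p).Finite :=
  Set.finite_of_ncard_ne_zero (by rw [ncard_halfOpenBox hM]; simpa using hM)

end Coordinates

/-- For `α` with nonzero entries: the vectors that point into the open cone over the rows of `M`
after a small displacement in the direction with coordinates `α`. -/
def LexPos {ι : Type*} [Fintype ι] [DecidableEq ι] (M : Matrix ι ι ℝ) (α : ι → ℝ) (y : ι → ℝ) :
    Prop :=
  ∀ i, 0 < coord M y i ∨ (coord M y i = 0 ∧ 0 < α i)

/-- Lattice points at height one that are `LexPos` in the cone over the rows of `M`. -/
def heightOne (M : Matrix (Fin 3) (Fin 3) ℤ) (α : Fin 3 → ℝ) : Set (Fin 3 → ℤ) :=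
  {x | LexPos (toRealMatrix M) α (toReal x) ∧ ∑ i, coord (toRealMatrix M) (toReal x) i = 1}

theorem heightOne_subset {M : Matrix (Fin 3) (Fin 3) ℤ} (hM : M.det ≠ 0) (α : Fin 3 → ℝ) :
    heightOne M α ⊆ halfOpenBox M (fun i => 0 < α i) ∪ Set.range M := by
  rintro x ⟨hx, hsum⟩
  have hR := det_toRealMatrix_ne_zero hM
  have h0 : ∀ i, 0 ≤ coord (toRealMatrix M) (toReal x) i := fun i => by
    rcases hx i with h | h
    · exact h.le
    · exact h.1.ge
  by_cases hone : ∃ i, coord (toRealMatrix M) (toReal x) i = 1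
  · right
    obtain ⟨i, hi⟩ := hone
    refine ⟨i, toReal_injective (coord_injective hR ?_)⟩
    have : coord (toRealMatrix M) (toReal (M i)) = Pi.single i 1 := coord_row hR i
    rw [this]
    ext j
    have h0' := h0
    simp only [Fin.sum_univ_three] at hsum
    have e0 := h0 0
    have e1 := h0 1
    have e2 := h0 2
    fin_cases i <;> fin_cases j <;> simp at hi ⊢ <;> linarith
  · left
    push Not at hone
    have hle : ∀ i, coord (toRealMatrix M) (toReal x) i ≤ 1 := fun i => by
      rw [← hsum]
      exact Finset.single_le_sum (fun j _ => h0 j) (Finset.mem_univ i)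
    refine fun i => ⟨fun _ => ⟨h0 i, lt_of_le_of_ne (hle i) (hone i)⟩, fun hi => ⟨?_, hle i⟩⟩
    rcases hx i with h | h
    · exact h
    · exact absurd h.2 hi

theorem finite_heightOne {M : Matrix (Fin 3) (Fin 3) ℤ} (hM : M.det ≠ 0) (α : Fin 3 → ℝ) :
    (heightOne M α).Finite :=
  ((finite_halfOpenBox hM _).union (Set.finite_range M)).subset (heightOne_subset hM α)

theorem ncard_heightOne_add_aux {M : Matrix (Fin 3) (Fin 3) ℤ} (hM : M.det ≠ 0) {α : Fin 3 → ℝ}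
    (hα : ∀ i, α i ≠ 0) (hneg : ¬ ∀ i, α i < 0)
    (h_integral : ∀ x : Fin 3 → ℤ, ∃ z : ℤ, ∑ i, coord (toRealMatrix M) (toReal x) i = z) :
    ((∀ i, 0 < α i) → (heightOne M α).ncard + (heightOne M (-α)).ncard = M.det.natAbs + 2) ∧
    ((¬ ∀ i, 0 < α i) → (heightOne M α).ncard + (heightOne M (-α)).ncard = M.det.natAbs) := by
  have hR := det_toRealMatrix_ne_zero hM
  set c : (Fin 3 → ℤ) → Fin 3 → ℝ := fun x => coord (toRealMatrix M) (toReal x) with hc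
  have hcsub : ∀ x y, c (x - y) = c x - c y := fun x y => by simp [hc]
  have hcinj : Function.Injective c := (coord_injective hR).comp toReal_injective
  have hrow : ∀ i, c (M i) = Pi.single i 1 := fun i => coord_row hR i
  set B := halfOpenBox M (fun i => 0 < α i) with hB
  have hBfin : B.Finite := finite_halfOpenBox hM _
  let H : ℤ → Set (Fin 3 → ℤ) := fun k => {x | x ∈ B ∧ ∑ i, c x i = k}
  have hHfin : ∀ k, (H k).Finite := fun k => hBfin.subset fun x hx => hx.1
  have hBmem : ∀ x, x ∈ B ↔ ∀ i, (0 < α i → 0 ≤ c x i ∧ c x i < 1) ∧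
    (¬ 0 < α i → 0 < c x i ∧ c x i ≤ 1) := fun x => Iff.rfl
  have hB01 : ∀ x ∈ B, ∀ i, 0 ≤ c x i ∧ c x i ≤ 1 := fun x hx i => by
    by_cases hi : 0 < α i
    · have := ((hBmem x).1 hx i).1 hi
      exact ⟨this.1, this.2.le⟩
    · have := ((hBmem x).1 hx i).2 hi
      exact ⟨this.1.le, this.2⟩
  have hsplit : B = H 0 ∪ (H 1 ∪ H 2) := by
    ext x
    constructor
    · intro hx
      obtain ⟨z, hz⟩ := h_integral x
      change ∑ i, c x i = z at hz
      have h01 := hB01 x hx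
      have hlt : ∑ i, c x i < 3 := by
        push Not at hneg
        obtain ⟨i, hi⟩ := hneg
        have hi' : c x i < 1 := (((hBmem x).1 hx i).1 (lt_of_le_of_ne hi (hα i).symm)).2
        calc ∑ i, c x i < ∑ _i : Fin 3, (1 : ℝ) :=
              Finset.sum_lt_sum (fun j _ => (h01 j).2) ⟨i, Finset.mem_univ i, hi'⟩
          _ = 3 := by simp
      have hge : 0 ≤ ∑ i, c x i := Finset.sum_nonneg fun j _ => (h01 j).1
      rw [hz] at hlt hge
      have h1 : z < 3 := by exact_mod_cast hlt
      have h2 : 0 ≤ z := by exact_mod_cast hge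
      obtain rfl | rfl | rfl : z = 0 ∨ z = 1 ∨ z = 2 := by omega
      · exact Or.inl ⟨hx, hz⟩
      · exact Or.inr (Or.inl ⟨hx, hz⟩)
      · exact Or.inr (Or.inr ⟨hx, hz⟩)
    · rintro (h | h | h) <;> exact h.1
  have hdisj : ∀ k l, k ≠ l → Disjoint (H k) (H l) := fun k l hkl =>
    Set.disjoint_left.2 fun x hx hx' => hkl (by exact_mod_cast hx.2.symm.trans hx'.2)
  have hcard : M.det.natAbs = (H 0).ncard + ((H 1).ncard + (H 2).ncard) := by
    rw [← ncard_halfOpenBox hM (fun i => 0 < α i), ← hB, hsplit,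
      Set.ncard_union_eq (Set.disjoint_union_right.2 ⟨hdisj 0 1 (by simp), hdisj 0 2 (by simp)⟩)
        (hHfin 0) ((hHfin 1).union (hHfin 2)),
      Set.ncard_union_eq (hdisj 1 2 (by simp)) (hHfin 1) (hHfin 2)]
  set w : Fin 3 → ℤ := Matrix.vecMul (fun _ => 1) M with hw
  have hcw : c w = fun _ => 1 := by
    simp only [hc, hw, toReal_vecMul, coord_vecMul hR]
    ext i; simp [toReal]
  have hminus : (heightOne M (-α)).ncard = (H 2).ncard := by
    have himg : (fun x => w - x) '' H 2 = heightOne M (-α) := by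
      ext y
      constructor
      · rintro ⟨x, ⟨hx, hs⟩, rfl⟩
        refine ⟨fun i => ?_, ?_⟩
        · change 0 < c (w - x) i ∨ c (w - x) i = 0 ∧ 0 < (-α) i
          rw [hcsub, hcw]
          simp only [Pi.sub_apply, Pi.neg_apply]
          rcases lt_or_gt_of_ne (hα i) with hi | hi
          · have := ((hBmem x).1 hx i).2 hi.not_gt
            rcases eq_or_lt_of_le this.2 with h | h
            · exact Or.inr ⟨by linarith, by linarith⟩
            · exact Or.inl (by linarith)
          · have := ((hBmem x).1 hx i).1 hi
            exact Or.inl (by linarith)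
        · change ∑ i, c (w - x) i = 1
          rw [hcsub, hcw]
          simp only [Pi.sub_apply, Finset.sum_sub_distrib, hs]
          simp; norm_num
      · rintro ⟨hy, hs⟩
        change ∑ i, c y i = 1 at hs
        have hy' : ∀ i, 0 < c y i ∨ c y i = 0 ∧ 0 < -α i := hy
        have h0 : ∀ i, 0 ≤ c y i := fun i => by
          rcases hy' i with h | h
          · exact h.le
          · exact h.1.ge
        have hle : ∀ i, c y i ≤ 1 := fun i => by
          rw [← hs]
          exact Finset.single_le_sum (fun j _ => h0 j) (Finset.mem_univ i)
        refine ⟨w - y, ⟨(hBmem _).2 fun i => ?_, ?_⟩, by simp⟩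
        · rw [hcsub, hcw]
          simp only [Pi.sub_apply]
          refine ⟨fun hi => ⟨by linarith [hle i], ?_⟩, fun hi => ⟨?_, by linarith [h0 i]⟩⟩
          · rcases hy' i with h | h <;> linarith
          · by_contra hcon
            have h1 : c y i = 1 := le_antisymm (hle i) (by linarith)
            push Not at hneg
            obtain ⟨j, hj⟩ := hneg
            have hji : j ≠ i := by rintro rfl; exact hα j (le_antisymm (not_lt.1 hi) hj)
            have h2 : 0 < c y j := by
              rcases hy' j with h | h
              · exact h
              · linarith
            have h3 : c y i + c y j ≤ ∑ k, c y k := by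
              rw [← Finset.sum_pair hji.symm]
              exact Finset.sum_le_univ_sum_of_nonneg h0
            linarith
        · rw [hcsub, hcw]
          simp only [Pi.sub_apply, Finset.sum_sub_distrib, hs]
          simp; norm_num
    rw [← himg, Set.ncard_image_of_injective _ (sub_right_injective)]
  have hH1 : H 1 ⊆ heightOne M α := by
    rintro x ⟨hx, hs⟩
    refine ⟨fun i => ?_, by simpa using hs⟩
    change 0 < c x i ∨ c x i = 0 ∧ 0 < α i
    by_cases hi : 0 < α i
    · rcases (((hBmem x).1 hx i).1 hi).1.eq_or_lt with h | h
      · exact Or.inr ⟨h.symm, hi⟩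
      · exact Or.inl h
    · exact Or.inl (((hBmem x).1 hx i).2 hi).1
  refine ⟨fun hpos => ?_, fun hpos => ?_⟩
  · have hplus : heightOne M α = H 1 ∪ Set.range M := by
      ext x
      constructor
      · intro hx
        rcases heightOne_subset hM α hx with h | h
        · exact Or.inl ⟨h, by simpa using hx.2⟩
        · exact Or.inr h
      · rintro (hx | ⟨i, rfl⟩)
        · exact hH1 hx
        · refine ⟨fun j => ?_, ?_⟩
          · change 0 < c (M i) j ∨ c (M i) j = 0 ∧ 0 < α j
            rw [hrow, Pi.single_apply]
            split_ifs
            · exact Or.inl one_pos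
            · exact Or.inr ⟨rfl, hpos j⟩
          · change ∑ j, c (M i) j = 1
            simp [hrow]
    have hdis : Disjoint (H 1) (Set.range M) := by
      refine Set.disjoint_left.2 ?_
      rintro _ hx ⟨i, rfl⟩
      have := (((hBmem _).1 hx.1 i).1 (hpos i)).2
      rw [hrow] at this
      simp at this
    have hMinj : Function.Injective M := fun i j h => by
      have h' : c (M i) j = c (M j) j := by rw [h]
      rw [hrow, hrow] at h'
      by_contra hij
      simp [Ne.symm hij] at h'
    have h3 : (Set.range M).ncard = 3 := by
      rw [Set.ncard_range_of_injective hMinj]; simp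
    have h00 : H 0 = {0} := by
      ext x
      constructor
      · rintro ⟨hx, hs⟩
        have : ∀ i ∈ Finset.univ, c x i = 0 :=
          (Finset.sum_eq_zero_iff_of_nonneg fun i _ => (hB01 x hx i).1).1 (by simpa using hs)
        refine hcinj ?_
        ext i
        rw [this i (Finset.mem_univ i)]
        simp [hc]
      · rintro rfl
        have hz : c 0 = 0 := by simp [hc]
        exact ⟨(hBmem _).2 fun i => ⟨fun _ => by simp [hz], fun h => absurd (hpos i) h⟩,
          by simp [hz]⟩
    rw [h00, Set.ncard_singleton] at hcard
    rw [hplus, Set.ncard_union_eq hdis (hHfin 1) (Set.finite_range M), h3, hminus, hcard]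
    ring
  · have hplus : heightOne M α = H 1 := by
      refine Set.Subset.antisymm (fun x hx => ?_) hH1
      rcases heightOne_subset hM α hx with h | ⟨i, rfl⟩
      · exact ⟨h, by simpa using hx.2⟩
      · refine ⟨(hBmem _).2 fun j => ?_, by simpa using hx.2⟩
        push Not at hpos
        obtain ⟨k, hk⟩ := hpos
        have hk' : ∀ j, ¬ 0 < α j → j = i := fun j hj => by
          have : 0 < c (M i) j := (hx.1 j).resolve_right fun h => hj h.2
          rw [hrow] at this
          by_contra hij
          simp [hij] at this
        rw [hrow]
        refine ⟨fun hj => ?_, fun hj => ?_⟩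
        · have : j ≠ i := by
            rintro rfl
            exact absurd (hk' k hk.not_gt) (by rintro rfl; linarith)
          simp [this]
        · simp [hk' j hj]
    have h00 : H 0 = ∅ := by
      refine Set.eq_empty_of_forall_notMem ?_
      rintro x ⟨hx, hs⟩
      have : ∀ i ∈ Finset.univ, c x i = 0 :=
        (Finset.sum_eq_zero_iff_of_nonneg fun i _ => (hB01 x hx i).1).1 (by simpa using hs)
      push Not at hpos
      obtain ⟨k, hk⟩ := hpos
      have := (((hBmem _).1 hx k).2 hk.not_gt).1
      linarith [‹∀ i ∈ Finset.univ, c x i = 0› k (Finset.mem_univ k)]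
    rw [h00, Set.ncard_empty] at hcard
    rw [hplus, hminus, hcard]
    ring

open Classical in
theorem ncard_heightOne_add {M : Matrix (Fin 3) (Fin 3) ℤ} (hM : M.det ≠ 0) {α : Fin 3 → ℝ}
    (hα : ∀ i, α i ≠ 0)
    (h_integral : ∀ x : Fin 3 → ℤ, ∃ z : ℤ, ∑ i, coord (toRealMatrix M) (toReal x) i = z) :
    (heightOne M α).ncard + (heightOne M (-α)).ncard = M.det.natAbs +
      ((if ∀ i, 0 < α i then 2 else 0) + (if ∀ i, 0 < (-α) i then 2 else 0)) := by
  by_cases hneg : ∀ i, α i < 0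
  · have h := (ncard_heightOne_add_aux (α := -α) hM (fun i => neg_ne_zero.2 (hα i))
      (fun h => by have := h 0; have := hneg 0; simp at *; linarith) h_integral).1
      (fun i => by simpa using hneg i)
    rw [neg_neg] at h
    rw [if_neg (fun h => (hneg 0).not_gt (h 0)), if_pos (fun i => by simpa using hneg i)]
    omega
  · have h := ncard_heightOne_add_aux hM hα hneg h_integral
    rw [if_neg (c := ∀ i, 0 < (-α) i) (fun h => hneg fun i => by simpa using h i)]
    split_ifs with hpos
    · exact h.1 hpos
    · exact h.2 hpos

/-- The part of the closed unit simplex lying in the open positive orthant. -/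
def cornerSimplex : Set (Fin 3 → ℝ) := {y | (∀ i, 0 < y i) ∧ ∑ i, y i ≤ 1}

theorem measurableSet_cornerSimplex : MeasurableSet cornerSimplex := by
  unfold cornerSimplex
  measurability

theorem volume_crossPolytope :
    volume {x : Fin 3 → ℝ | ∑ i, |x i| ≤ 1} = ENNReal.ofReal (8 / 6) := by
  have h := volume_sum_rpow_le (Fin 3) (p := 1) le_rfl 1
  have h4 : Real.Gamma (3 + 1) = 6 := by
    rw [show (3 : ℝ) = (3 : ℕ) by norm_num, Real.Gamma_nat_eq_factorial]; norm_num [Nat.factorial]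
  have h2 : Real.Gamma (1 + 1) = 1 := by
    rw [Real.Gamma_add_one one_ne_zero, Real.Gamma_one]; norm_num
  simp only [Real.rpow_one, div_one, ENNReal.ofReal_one, one_pow, one_mul, Fintype.card_fin, h2]
    at h
  rw [h]
  push_cast
  rw [h4]
  norm_num

theorem ae_ne_zero_of_fin_three : ∀ᵐ x : Fin 3 → ℝ, ∀ i, x i ≠ 0 := by
  rw [ae_all_iff]
  intro i
  have h := Measure.addHaar_submodule (volume : Measure (Fin 3 → ℝ))
    (LinearMap.ker (LinearMap.proj (R := ℝ) (φ := fun _ : Fin 3 => ℝ) i)) (fun h => by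
      have : (Pi.single i 1 : Fin 3 → ℝ) ∈
          LinearMap.ker (LinearMap.proj (R := ℝ) (φ := fun _ : Fin 3 => ℝ) i) := h ▸ trivial
      simp at this)
  rw [ae_iff]
  convert h using 2
  ext x; simp

theorem volume_cornerSimplex : volume cornerSimplex = ENNReal.ofReal (1 / 6) := by
  let f : (Fin 3 → ℤˣ) → (Fin 3 → ℝ) →ₗ[ℝ] (Fin 3 → ℝ) := fun e =>
    Matrix.toLin' (Matrix.diagonal fun i => ((e i : ℤ) : ℝ))
  have hf : ∀ e x i, f e x i = ((e i : ℤ) : ℝ) * x i := fun e x i => by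
    simp [f, Matrix.mulVec_diagonal]
  have habs : ∀ u : ℤˣ, |((u : ℤ) : ℝ)| = 1 := fun u => by
    rcases Int.units_eq_one_or u with rfl | rfl <;> simp
  have hdet : ∀ e, |LinearMap.det (f e)| = 1 := fun e => by
    rw [LinearMap.det_toLin', Matrix.det_diagonal, Finset.abs_prod]
    simp [habs]
  have hdet0 : ∀ e, LinearMap.det (f e) ≠ 0 := fun e h => by
    have := hdet e
    rw [h] at this; simp at this
  have hvol : ∀ e, volume (f e ⁻¹' cornerSimplex) = volume cornerSimplex := fun e => by
    rw [Measure.addHaar_preimage_linearMap _ (hdet0 e), abs_inv, hdet]; simp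
  have hunion : {x : Fin 3 → ℝ | ∑ i, |x i| ≤ 1} =ᵐ[volume]
      ⋃ e ∈ (Finset.univ : Finset (Fin 3 → ℤˣ)), f e ⁻¹' cornerSimplex := by
    filter_upwards [ae_ne_zero_of_fin_three] with x hx
    refine propext ?_
    change ∑ i, |x i| ≤ 1 ↔ x ∈ ⋃ e ∈ (Finset.univ : Finset (Fin 3 → ℤˣ)), f e ⁻¹' cornerSimplex
    simp only [Finset.mem_univ, Set.iUnion_true, Set.mem_iUnion, Set.mem_preimage]
    constructor
    · intro h
      refine ⟨fun i => if 0 < x i then 1 else -1, ?_⟩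
      have hval : ∀ i, f (fun i => if 0 < x i then 1 else -1) x i = |x i| := fun i => by
        rw [hf]
        split_ifs with h0
        · simp [abs_of_pos h0]
        · simp [abs_of_nonpos (not_lt.1 h0)]
      exact ⟨fun i => by rw [hval]; exact abs_pos.2 (hx i), by simpa only [hval] using h⟩
    · rintro ⟨e, he, hs⟩
      have hval : ∀ i, |x i| = f e x i := fun i => by
        rw [← abs_of_pos (he i), hf, abs_mul, habs, one_mul]
      simpa only [hval] using hs
  have hdisj : Set.Pairwise (↑(Finset.univ : Finset (Fin 3 → ℤˣ)))
      (Function.onFun (AEDisjoint volume) fun e => f e ⁻¹' cornerSimplex) := by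
    refine fun e _ e' _ hne => Disjoint.aedisjoint (Set.disjoint_left.2 ?_)
    rintro x ⟨hx, -⟩ ⟨hx', -⟩
    refine hne (funext fun i => ?_)
    have h1 := hx i
    have h2 := hx' i
    rw [hf] at h1 h2
    rcases Int.units_eq_one_or (e i) with h | h <;> rcases Int.units_eq_one_or (e' i) with h' | h'
      <;> rw [h, h'] <;> rw [h] at h1 <;> rw [h'] at h2 <;> simp at h1 h2 <;> linarith
  have hmeas : ∀ e ∈ (Finset.univ : Finset (Fin 3 → ℤˣ)),
      NullMeasurableSet (f e ⁻¹' cornerSimplex) := fun e _ =>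
    ((f e).continuous_of_finiteDimensional.measurable
      measurableSet_cornerSimplex).nullMeasurableSet
  have hsum := measure_congr hunion
  rw [volume_crossPolytope, measure_biUnion_finset₀ hdisj hmeas] at hsum
  simp only [hvol] at hsum
  have hc : (Finset.univ : Finset (Fin 3 → ℤˣ)).card = 8 := by simp
  rw [Finset.sum_const, hc, nsmul_eq_mul] at hsum
  have h8 : ENNReal.ofReal (8 / 6) = 8 * ENNReal.ofReal (1 / 6) := by
    rw [show (8 / 6 : ℝ) = 8 * (1 / 6) by norm_num, ENNReal.ofReal_mul (by norm_num)]
    norm_num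
  rw [h8] at hsum
  exact ((ENNReal.mul_right_inj (by simp) (by simp)).1 hsum).symm

theorem volume_coord_preimage_cornerSimplex {M : Matrix (Fin 3) (Fin 3) ℝ} (hM : M.det ≠ 0) :
    volume (coord M ⁻¹' cornerSimplex) * 6 = ENNReal.ofReal |M.det| := by
  have h : LinearMap.det (coord M) ≠ 0 := by rw [det_coord]; exact inv_ne_zero hM
  rw [Measure.addHaar_preimage_linearMap _ h, det_coord, inv_inv, volume_cornerSimplex, mul_assoc,
    show (6 : ENNReal) = ENNReal.ofReal 6 by simp, ← ENNReal.ofReal_mul (by norm_num)]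
  norm_num

section Hull

open scoped Pointwise

variable {ι E : Type*} [Fintype ι] [AddCommGroup E] [Module ℝ E]

theorem mem_convexHull_range_iff {s : ι → E} {y : E} :
    y ∈ convexHull ℝ (range s) ↔
      ∃ w : ι → ℝ, (∀ j, 0 ≤ w j) ∧ ∑ j, w j = 1 ∧ ∑ j, w j • s j = y := by
  classical
  have h : range s = Fintype.linearCombination ℝ s '' range (fun j : ι => Pi.single j (1 : ℝ)) := by
    rw [← range_comp]
    congr 1
    ext j
    simp
  rw [h, ← LinearMap.image_convexHull, convexHull_rangle_single_eq_stdSimplex]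
  constructor
  · rintro ⟨w, ⟨h0, h1⟩, rfl⟩
    exact ⟨w, h0, h1, (Fintype.linearCombination_apply ..).symm⟩
  · rintro ⟨w, h0, h1, rfl⟩
    exact ⟨w, ⟨h0, h1⟩, Fintype.linearCombination_apply ..⟩

theorem zero_mem_interior_convexHull_smul [TopologicalSpace E] [ContinuousConstSMul ℝ E]
    {s : ι → E} {c : ι → ℝ} (hc : ∀ j, 0 < c j)
    (h : (0 : E) ∈ interior (convexHull ℝ (range s))) :
    (0 : E) ∈ interior (convexHull ℝ (range fun j => c j • s j)) := by
  obtain ⟨w, hw0, hw1, hw⟩ := mem_convexHull_range_iff.1 (interior_subset h)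
  have hne : Nonempty ι := by
    by_contra hcon
    rw [not_nonempty_iff] at hcon
    simp at hw1
  have h0 : (0 : E) ∈ convexHull ℝ (range fun j => c j • s j) := by
    have hpos : ∀ j, 0 ≤ w j / c j := fun j => div_nonneg (hw0 j) (hc j).le
    have hW : 0 < ∑ j, w j / c j := by
      refine (Finset.sum_nonneg fun j _ => hpos j).lt_of_ne fun hz => ?_
      have hz' := (Finset.sum_eq_zero_iff_of_nonneg fun j _ => hpos j).1 hz.symm
      have : ∀ j, w j = 0 := fun j => by
        have := hz' j (Finset.mem_univ j)
        rwa [div_eq_zero_iff, or_iff_left (hc j).ne'] at this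
      simp [this] at hw1
    refine mem_convexHull_range_iff.2 ⟨fun j => (∑ k, w k / c k)⁻¹ * (w j / c j),
      fun j => mul_nonneg (inv_nonneg.2 hW.le) (hpos j), ?_, ?_⟩
    · rw [← Finset.mul_sum, inv_mul_cancel₀ hW.ne']
    · have : ∀ j, ((∑ k, w k / c k)⁻¹ * (w j / c j)) • c j • s j =
          (∑ k, w k / c k)⁻¹ • w j • s j := fun j => by
        rw [smul_smul, mul_assoc, div_mul_cancel₀ _ (hc j).ne', mul_smul]
      simp only [this]
      rw [← Finset.smul_sum, hw, smul_zero]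
  obtain ⟨k, hk⟩ := Finite.exists_min c
  have hsub : c k • convexHull ℝ (range s) ⊆ convexHull ℝ (range fun j => c j • s j) := by
    rw [← convexHull_smul]
    refine convexHull_min ?_ (convex_convexHull _ _)
    rintro _ ⟨_, ⟨j, rfl⟩, rfl⟩
    have hj : c j • s j ∈ convexHull ℝ (range fun j => c j • s j) :=
      subset_convexHull _ _ ⟨j, rfl⟩
    have := (convex_convexHull ℝ (range fun j => c j • s j)).smul_mem_of_zero_mem h0 hj
      (t := c k / c j) ⟨div_nonneg (hc k).le (hc j).le, (div_le_one (hc j)).2 (hk j)⟩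
    rwa [smul_smul, div_mul_cancel₀ _ (hc j).ne'] at this
  refine interior_mono hsub ?_
  rw [interior_smul₀ (hc k).ne']
  exact ⟨0, h, smul_zero _⟩

theorem exists_supporting_functional [TopologicalSpace E] [IsTopologicalAddGroup E]
    [ContinuousSMul ℝ E] [T2Space E]
    {s : ι → E} {c : ι → ℝ} (hc : ∀ j, 0 < c j)
    (h : (0 : E) ∈ interior (convexHull ℝ (range s))) {y : E} (hy : y ≠ 0) :
    ∃ f : E →ₗ[ℝ] ℝ, (∀ j, f (s j) ≤ c j) ∧ ∃ w : ι → ℝ, (∀ j, 0 ≤ w j) ∧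
      ∑ j, w j • s j = y ∧ ∀ j, w j ≠ 0 → f (s j) = c j := by
  set P := convexHull ℝ (range fun j => (c j)⁻¹ • s j) with hP
  have h0 : (0 : E) ∈ interior P :=
    zero_mem_interior_convexHull_smul (fun j => inv_pos.2 (hc j)) h
  have hconv : Convex ℝ P := convex_convexHull _ _
  have hcomp : IsCompact P := (finite_range _).isCompact_convexHull ℝ
  have hnhds : P ∈ nhds (0 : E) := mem_interior_iff_mem_nhds.1 h0
  have hg : 0 < gauge P y :=
    (gauge_pos (absorbent_nhds_zero hnhds) (hcomp.isVonNBounded ℝ)).2 hy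
  have hfront : (gauge P y)⁻¹ • y ∈ frontier P := by
    rw [← gauge_eq_one_iff_mem_frontier hconv hnhds, gauge_smul_of_nonneg (inv_nonneg.2 hg.le),
      smul_eq_mul, inv_mul_cancel₀ hg.ne']
  set x := (gauge P y)⁻¹ • y with hx
  obtain ⟨f, hf⟩ := geometric_hahn_banach_open_point hconv.interior isOpen_interior hfront.2
  have hfx : 0 < f x := by simpa using hf 0 h0
  have hfP : ∀ a ∈ P, f a ≤ f x := by
    intro a ha
    have hcl : a ∈ closure (interior P) := by
      rw [hconv.closure_interior_eq_closure_of_nonempty_interior ⟨0, h0⟩]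
      exact subset_closure ha
    exact closure_minimal (fun b hb => (hf b hb).le) (isClosed_le f.continuous continuous_const) hcl
  have hxP : x ∈ P := by
    have := hfront.1
    rwa [hcomp.isClosed.closure_eq] at this
  obtain ⟨w, hw0, hw1, hw⟩ := mem_convexHull_range_iff.1 hxP
  have hle : ∀ j, f (s j) ≤ c j * f x := fun j => by
    have := hfP ((c j)⁻¹ • s j) (subset_convexHull _ _ ⟨j, rfl⟩)
    rw [map_smul, smul_eq_mul, inv_mul_le_iff₀ (hc j)] at this
    exact this
  have heq : ∀ j, w j * ((c j)⁻¹ * f (s j)) = w j * f x := by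
    have hle' : ∀ j ∈ Finset.univ, w j * ((c j)⁻¹ * f (s j)) ≤ w j * f x := fun j _ =>
      mul_le_mul_of_nonneg_left ((inv_mul_le_iff₀ (hc j)).2 (hle j)) (hw0 j)
    have hsum : ∑ j, w j * ((c j)⁻¹ * f (s j)) = ∑ j, w j * f x := by
      rw [← Finset.sum_mul, hw1, one_mul]
      conv_rhs => rw [← hw]
      simp
    exact fun j => (Finset.sum_eq_sum_iff_of_le hle').1 hsum j (Finset.mem_univ j)
  refine ⟨(f x)⁻¹ • (f : E →ₗ[ℝ] ℝ), fun j => ?_,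
    fun j => gauge P y * (w j * (c j)⁻¹), fun j => ?_, ?_, fun j hj => ?_⟩
  · simp only [LinearMap.smul_apply, smul_eq_mul, ContinuousLinearMap.coe_coe]
    rw [inv_mul_le_iff₀ hfx, mul_comm]
    exact hle j
  · exact mul_nonneg hg.le (mul_nonneg (hw0 j) (inv_nonneg.2 (hc j).le))
  · simp only [mul_smul, ← Finset.smul_sum]
    rw [hw, hx, smul_smul, mul_inv_cancel₀ hg.ne', one_smul]
  · have hwj : w j ≠ 0 := by rintro h; simp [h] at hj
    have := mul_left_cancel₀ hwj (heq j)
    rw [inv_mul_eq_iff_eq_mul₀ (hc j).ne'] at this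
    simp only [LinearMap.smul_apply, smul_eq_mul, ContinuousLinearMap.coe_coe]
    rw [this, mul_comm, mul_assoc, mul_inv_cancel₀ hfx.ne', mul_one]

end Hull

section Fan
variable {n : ℕ}

/-- The matrix whose rows are the vectors of `s` indexed by `σ`. -/
def rows {R : Type*} (s : Fin n → Fin 3 → R) (σ : Fin 3 ↪o Fin n) : Matrix (Fin 3) (Fin 3) R :=
  fun i => s (σ i)

/-- The linear functional that takes the value `c (σ i)` at `s (σ i)`. -/
def interp (c : Fin n → ℝ) (s : Fin n → Fin 3 → ℝ) (σ : Fin 3 ↪o Fin n) : (Fin 3 → ℝ) →ₗ[ℝ] ℝ :=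
  Fintype.linearCombination ℝ (fun i => c (σ i)) ∘ₗ coord (rows s σ)

theorem interp_apply (c : Fin n → ℝ) (s : Fin n → Fin 3 → ℝ) (σ : Fin 3 ↪o Fin n) (y : Fin 3 → ℝ) :
    interp c s σ y = ∑ i, coord (rows s σ) y i * c (σ i) := by
  simp [interp, Fintype.linearCombination_apply]

theorem interp_vertex {s : Fin n → Fin 3 → ℝ} {σ : Fin 3 ↪o Fin n} (hσ : (rows s σ).det ≠ 0)
    (c : Fin n → ℝ) (i : Fin 3) : interp c s σ (s (σ i)) = c (σ i) := by
  have : coord (rows s σ) (s (σ i)) = Pi.single i 1 := coord_row hσ i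
  rw [interp_apply, this]
  simp [Pi.single_apply]

theorem eq_interp {s : Fin n → Fin 3 → ℝ} {σ : Fin 3 ↪o Fin n} (hσ : (rows s σ).det ≠ 0)
    {c : Fin n → ℝ} {f : (Fin 3 → ℝ) →ₗ[ℝ] ℝ} (hf : ∀ i, f (s (σ i)) = c (σ i)) (y : Fin 3 → ℝ) :
    f y = interp c s σ y := by
  conv_lhs => rw [← sum_coord_smul hσ y]
  rw [interp_apply, map_sum]
  exact Finset.sum_congr rfl fun i _ => by rw [map_smul, smul_eq_mul]; congr 1; exact hf i

/-- Positive weights on the vectors `s` that interpolate no further vector of `s` linearly, and that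
are close to being constant. -/
structure IsGenericCost (s : Fin n → Fin 3 → ℝ) (c : Fin n → ℝ) : Prop where
  pos : ∀ j, 0 < c j
  ne : ∀ (σ : Fin 3 ↪o Fin n) j, j ∉ range σ → interp c s σ (s j) ≠ c j
  lt : ∀ (σ : Fin 3 ↪o Fin n) j, 1 < ∑ i, coord (rows s σ) (s j) i → c j < interp c s σ (s j)

theorem exists_isGenericCost (s : Fin n → Fin 3 → ℝ) : ∃ c, IsGenericCost s c := by
  have hcont : ∀ σ j, Continuous fun c : Fin n → ℝ => interp c s σ (s j) := fun σ j => by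
    simp only [interp_apply]
    fun_prop
  have hopen : ∀ᶠ c in nhds (fun _ : Fin n => (1 : ℝ)), (∀ j, 0 < c j) ∧
      ∀ σ j, 1 < ∑ i, coord (rows s σ) (s j) i → c j < interp c s σ (s j) := by
    refine Filter.Eventually.and ?_ ?_
    · refine Filter.eventually_all.2 fun j => ?_
      exact (continuous_apply j).tendsto _ |>.eventually (lt_mem_nhds one_pos)
    · refine Filter.eventually_all.2 fun σ => Filter.eventually_all.2 fun j => ?_
      by_cases h : 1 < ∑ i, coord (rows s σ) (s j) i
      · simp only [h, true_imp_iff]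
        refine ((continuous_apply j).tendsto _).eventually_lt ((hcont σ j).tendsto _) ?_
        simpa [interp_apply] using h
      · simp [h]
  have hae : ∀ᵐ c : Fin n → ℝ, ∀ (σ : Fin 3 ↪o Fin n) j,
      j ∉ range σ → interp c s σ (s j) ≠ c j := by
    refine ae_all_iff.2 fun σ => ae_all_iff.2 fun j => ?_
    by_cases hj : j ∈ range σ
    · simp [hj]
    let L : (Fin n → ℝ) →ₗ[ℝ] ℝ :=
      (∑ i, coord (rows s σ) (s j) i • LinearMap.proj (σ i)) - LinearMap.proj j
    have hL : ∀ c, L c = interp c s σ (s j) - c j := fun c => by simp [L, interp_apply]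
    have hker : LinearMap.ker L ≠ ⊤ := fun h => by
      have h1 : L (Pi.single j 1) = 0 := by
        rw [← LinearMap.mem_ker, h]; trivial
      have h2 : ∀ i, σ i ≠ j := fun i hi => hj ⟨i, hi⟩
      rw [hL, interp_apply] at h1
      simp [h2] at h1
    filter_upwards [measure_eq_zero_iff_ae_notMem.1 (Measure.addHaar_submodule volume _ hker)]
      with c hc _ h
    exact hc (by simp [hL, h])
  obtain ⟨U, hU, hUo, h1⟩ := eventually_nhds_iff.1 hopen
  obtain ⟨c, hc, hcU⟩ := (Measure.dense_of_ae hae).exists_mem_open hUo ⟨_, h1⟩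
  exact ⟨c, (hU c hcU).1, hc, (hU c hcU).2⟩

/-- Vectors outside all the planes spanned by two vectors of `s`. -/
def IsGenericVector (s : Fin n → Fin 3 → ℝ) (y : Fin 3 → ℝ) : Prop :=
  ∀ a b, y ∉ Submodule.span ℝ {s a, s b}

theorem span_pair_ne_top (v w : Fin 3 → ℝ) : Submodule.span ℝ {v, w} ≠ ⊤ := fun h => by
  classical
  have h1 := finrank_span_finset_le_card (R := ℝ) ({v, w} : Finset (Fin 3 → ℝ))
  have h2 : ({v, w} : Finset (Fin 3 → ℝ)).card ≤ 2 := Finset.card_le_two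
  rw [Set.finrank, Finset.coe_pair, h, finrank_top, Module.finrank_fin_fun] at h1
  omega

theorem ae_isGenericVector (s : Fin n → Fin 3 → ℝ) : ∀ᵐ y, IsGenericVector s y :=
  ae_all_iff.2 fun _ => ae_all_iff.2 fun _ =>
    measure_eq_zero_iff_ae_notMem.1 (Measure.addHaar_submodule volume _ (span_pair_ne_top _ _))

theorem IsGenericVector.neg {s : Fin n → Fin 3 → ℝ} {y : Fin 3 → ℝ} (h : IsGenericVector s y) :
    IsGenericVector s (-y) := fun a b hy => h a b (by simpa using neg_mem hy)

theorem IsGenericVector.eventually_add_smul {s : Fin n → Fin 3 → ℝ} {u : Fin 3 → ℝ}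
    (h : IsGenericVector s u) (x : Fin 3 → ℝ) :
    ∀ᶠ ε : ℝ in nhdsWithin 0 (Ioi 0), IsGenericVector s (x + ε • u) := by
  refine Filter.eventually_all.2 fun a => Filter.eventually_all.2 fun b => ?_
  have hsub : {ε : ℝ | x + ε • u ∈ Submodule.span ℝ {s a, s b}}.Subsingleton := by
    intro ε hε δ hδ
    by_contra hne
    have h1 : (ε - δ) • u ∈ Submodule.span ℝ {s a, s b} := by
      have := Submodule.sub_mem _ (mem_ofPred.1 hε) (mem_ofPred.1 hδ)
      rwa [add_sub_add_left_eq_sub, ← sub_smul] at this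
    exact h a b ((Submodule.smul_mem_iff _ (sub_ne_zero.2 hne)).1 h1)
  have hfin := hsub.finite.subset (sdiff_subset (t := {0}))
  have hmem : ({ε : ℝ | x + ε • u ∈ Submodule.span ℝ {s a, s b}} \ {0})ᶜ ∈ nhds (0 : ℝ) :=
    hfin.isClosed.isOpen_compl.mem_nhds (by simp)
  filter_upwards [mem_nhdsWithin_of_mem_nhds hmem, self_mem_nhdsWithin] with ε h1 h2 h3
  exact h1 ⟨h3, (ne_of_gt h2 : ε ≠ 0)⟩

theorem IsGenericVector.coord_ne_zero {s : Fin n → Fin 3 → ℝ} {y : Fin 3 → ℝ}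
    (h : IsGenericVector s y) {σ : Fin 3 ↪o Fin n} (hσ : (rows s σ).det ≠ 0) (i : Fin 3) :
    coord (rows s σ) y i ≠ 0 := fun hi => by
  have key : ∀ a b, a ≠ i → b ≠ i → a ≠ b → False := fun a b ha hb hab => by
    refine h (σ a) (σ b) ?_
    rw [← sum_coord_smul hσ y]
    refine Submodule.sum_mem _ fun k _ => ?_
    by_cases hk : k = i
    · rw [hk, hi, zero_smul]; exact zero_mem _
    · refine Submodule.smul_mem _ _ (Submodule.subset_span ?_)
      have : k = a ∨ k = b := by omega
      rcases this with rfl | rfl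
      · exact Or.inl rfl
      · exact Or.inr rfl
  fin_cases i
  · exact key 1 2 (by decide) (by decide) (by decide)
  · exact key 0 2 (by decide) (by decide) (by decide)
  · exact key 0 1 (by decide) (by decide) (by decide)

/-- The cells of the regular triangulation of the fan over `s` defined by the weights `c`. -/
def cells (s : Fin n → Fin 3 → ℝ) (c : Fin n → ℝ) : Set (Fin 3 ↪o Fin n) :=
  {σ | (rows s σ).det ≠ 0 ∧ ∀ j, interp c s σ (s j) ≤ c j}

theorem sum_coord_le_one {s : Fin n → Fin 3 → ℝ} {c : Fin n → ℝ} (hc : IsGenericCost s c)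
    {σ : Fin 3 ↪o Fin n} (hσ : σ ∈ cells s c) (j : Fin n) :
    ∑ i, coord (rows s σ) (s j) i ≤ 1 :=
  le_of_not_gt fun h => (hσ.2 j).not_gt (hc.lt σ j h)

/-- The open cone over the vectors of `s` indexed by `σ`. -/
def openCone (s : Fin n → Fin 3 → ℝ) (σ : Fin 3 ↪o Fin n) : Set (Fin 3 → ℝ) :=
  {y | ∀ i, 0 < coord (rows s σ) y i}

theorem eq_of_mem_openCone {s : Fin n → Fin 3 → ℝ} {c : Fin n → ℝ} (hc : IsGenericCost s c)
    {σ τ : Fin 3 ↪o Fin n} (hσ : σ ∈ cells s c) (hτ : τ ∈ cells s c) {y : Fin 3 → ℝ}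
    (hyσ : y ∈ openCone s σ) (hyτ : y ∈ openCone s τ) : σ = τ := by
  have key : ∀ {σ τ : Fin 3 ↪o Fin n}, σ ∈ cells s c → τ ∈ cells s c → y ∈ openCone s τ →
      interp c s σ y ≤ interp c s τ y ∧
      (interp c s σ y = interp c s τ y → range τ ⊆ range σ) := by
    intro σ τ hσ hτ hy
    have h1 : interp c s σ y = ∑ i, coord (rows s τ) y i * interp c s σ (s (τ i)) := by
      conv_lhs => rw [← sum_coord_smul hτ.1 y]
      rw [map_sum]
      exact Finset.sum_congr rfl fun i _ => by rw [map_smul, smul_eq_mul]; rfl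
    have hle : ∀ i ∈ Finset.univ, coord (rows s τ) y i * interp c s σ (s (τ i)) ≤
        coord (rows s τ) y i * c (τ i) := fun i _ =>
      mul_le_mul_of_nonneg_left (hσ.2 _) (hy i).le
    rw [h1, interp_apply c s τ]
    refine ⟨Finset.sum_le_sum hle, fun heq => ?_⟩
    rintro _ ⟨i, rfl⟩
    by_contra hi
    exact hc.ne σ _ hi (mul_left_cancel₀ (hy i).ne'
      ((Finset.sum_eq_sum_iff_of_le hle).1 heq i (Finset.mem_univ i)))
  have h := (key hσ hτ hyτ).1.antisymm (key hτ hσ hyσ).1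
  exact OrderEmbedding.range_inj.1
    (((key hτ hσ hyσ).2 h.symm).antisymm ((key hσ hτ hyτ).2 h))

theorem exists_mem_openCone {s : Fin n → Fin 3 → ℝ} {c : Fin n → ℝ} (hc : IsGenericCost s c)
    (h0 : (0 : Fin 3 → ℝ) ∈ interior (convexHull ℝ (range s))) {y : Fin 3 → ℝ}
    (hy : IsGenericVector s y) : ∃ σ ∈ cells s c, y ∈ openCone s σ := by
  classical
  have hne : Nonempty (Fin n) := by
    by_contra hcon
    rw [not_nonempty_iff] at hcon
    simp [Set.range_eq_empty] at h0
  obtain ⟨j₀⟩ := hne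
  have hy0 : y ≠ 0 := fun h => hy j₀ j₀ (h ▸ zero_mem _)
  obtain ⟨f, hf, w, hw0, hw, hwf⟩ := exists_supporting_functional hc.pos h0 hy0
  set J : Set (Fin n) := {j | f (s j) = c j} with hJ
  obtain ⟨κ, a, ha, hspan, hli⟩ := exists_linearIndependent' ℝ (fun j : J => s j)
  have hyspan : y ∈ Submodule.span ℝ (range ((fun j : J => s j) ∘ a)) := by
    rw [hspan, ← hw]
    refine Submodule.sum_mem _ fun j _ => ?_
    by_cases hj : w j = 0
    · rw [hj, zero_smul]; exact zero_mem _
    · exact Submodule.smul_mem _ _ (Submodule.subset_span ⟨⟨j, hwf j hj⟩, rfl⟩)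
  have hainj : Function.Injective fun k => (a k : Fin n) := Subtype.val_injective.comp ha
  have : Finite κ := Finite.of_injective _ hainj
  have := Fintype.ofFinite κ
  set A : Finset (Fin n) := Finset.univ.image fun k => (a k : Fin n) with hA
  have hAcard : A.card = Fintype.card κ := Finset.card_image_of_injective _ hainj
  have hle3 : Fintype.card κ ≤ 3 := by simpa using hli.fintype_card_le_finrank
  have hge3 : ¬ A.card ≤ 2 := fun h2 => by
    obtain ⟨p, q, hpq⟩ : ∃ p q, A ⊆ {p, q} := by
      interval_cases h : A.card
      · exact ⟨j₀, j₀, by simp [Finset.card_eq_zero.1 h]⟩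
      · obtain ⟨p, hp⟩ := Finset.card_eq_one.1 h
        exact ⟨p, p, by simp [hp]⟩
      · obtain ⟨p, q, -, hpq⟩ := Finset.card_eq_two.1 h
        exact ⟨p, q, hpq.le⟩
    refine hy p q (Submodule.span_mono ?_ hyspan)
    rintro _ ⟨k, rfl⟩
    have : (a k : Fin n) ∈ ({p, q} : Finset (Fin n)) :=
      hpq (Finset.mem_image_of_mem _ (Finset.mem_univ k))
    simp only [Finset.mem_insert, Finset.mem_singleton] at this
    rcases this with h | h <;> simp [h]
  have hA3 : A.card = 3 := by omega
  set σ := A.orderEmbOfFin hA3 with hσdef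
  have hσrange : range σ = A := Finset.range_orderEmbOfFin A hA3
  have hσJ : ∀ i, f (s (σ i)) = c (σ i) := fun i => by
    have : σ i ∈ A := Finset.orderEmbOfFin_mem A hA3 i
    obtain ⟨k, -, hk⟩ := Finset.mem_image.1 this
    rw [← hk]; exact (a k).2
  have hdet : (rows s σ).det ≠ 0 := by
    have hσA : ∀ i, ∃ k, (a k : Fin n) = σ i := fun i => by
      have : σ i ∈ A := Finset.orderEmbOfFin_mem A hA3 i
      obtain ⟨k, -, hk⟩ := Finset.mem_image.1 this
      exact ⟨k, hk⟩
    choose e he using hσA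
    have heinj : Function.Injective e := fun i j hij => σ.injective (by rw [← he, hij, he])
    have hli' : LinearIndependent ℝ (rows s σ).row := by
      have h : (rows s σ).row = ((fun j : J => s j) ∘ a) ∘ e := by
        ext i : 1
        simp [rows, he, Matrix.row]
      rw [h]
      exact hli.comp e heinj
    have := Matrix.linearIndependent_rows_iff_isUnit.1 hli'
    exact ((Matrix.isUnit_iff_isUnit_det _).1 this).ne_zero
  have hfi : ∀ z, f z = interp c s σ z := eq_interp hdet hσJ
  have hσc : σ ∈ cells s c := ⟨hdet, fun j => by rw [← hfi]; exact hf j⟩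
  refine ⟨σ, hσc, fun i => ?_⟩
  have hsupp : ∀ j, j ∉ range σ → w j = 0 := fun j hj => by
    by_contra hwj
    exact hc.ne σ j hj (by rw [← hfi]; exact hwf j hwj)
  have hyσ : y = ∑ i, w (σ i) • rows s σ i := by
    rw [← hw]
    symm
    refine Fintype.sum_of_injective σ σ.injective _ _ (fun j hj => ?_) fun i => rfl
    rw [hsupp j hj, zero_smul]
  have hci : coord (rows s σ) y i = w (σ i) := by
    rw [hyσ, coord_sum_smul hdet fun i => w (σ i)]
  exact lt_of_le_of_ne (hci ▸ hw0 _) (hy.coord_ne_zero hdet i).symm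

end Fan

theorem eventually_pos_add_mul_iff (a b : ℝ) :
    ∀ᶠ ε : ℝ in nhdsWithin 0 (Ioi 0), 0 < a + ε * b ↔ (0 < a ∨ (a = 0 ∧ 0 < b)) := by
  have hlim : Filter.Tendsto (fun ε : ℝ => a + ε * b) (nhdsWithin 0 (Ioi 0)) (nhds a) := by
    have : Continuous fun ε : ℝ => a + ε * b := by fun_prop
    simpa using (this.tendsto 0).mono_left nhdsWithin_le_nhds
  rcases lt_trichotomy a 0 with ha | rfl | ha
  · filter_upwards [hlim.eventually (gt_mem_nhds ha)] with ε hε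
    simp [hε.le.not_gt, ha.ne, ha.le.not_gt]
  · filter_upwards [self_mem_nhdsWithin] with ε hε
    simp [mul_pos_iff_of_pos_left (mem_Ioi.1 hε)]
  · filter_upwards [hlim.eventually (lt_mem_nhds ha)] with ε hε
    simp [hε, ha]

section Count
variable {n : ℕ}

theorem eventually_mem_openCone_iff (s : Fin n → Fin 3 → ℝ) (σ : Fin 3 ↪o Fin n)
    (x u : Fin 3 → ℝ) :
    ∀ᶠ ε : ℝ in nhdsWithin 0 (Ioi 0),
      x + ε • u ∈ openCone s σ ↔ LexPos (rows s σ) (coord (rows s σ) u) x := by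
  filter_upwards [Filter.eventually_all.2 fun i =>
    eventually_pos_add_mul_iff (coord (rows s σ) x i) (coord (rows s σ) u i)] with ε hε
  simp only [openCone, LexPos, mem_ofPred_eq, map_add, map_smul, Pi.add_apply, Pi.smul_apply,
    smul_eq_mul, hε]

theorem existsUnique_lexPos {s : Fin n → Fin 3 → ℝ} {c : Fin n → ℝ} (hc : IsGenericCost s c)
    (h0 : (0 : Fin 3 → ℝ) ∈ interior (convexHull ℝ (range s))) {u : Fin 3 → ℝ}
    (hu : IsGenericVector s u) (x : Fin 3 → ℝ) :
    ∃! σ, σ ∈ cells s c ∧ LexPos (rows s σ) (coord (rows s σ) u) x := by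
  obtain ⟨ε, hε, hgen⟩ := ((Filter.eventually_all.2 fun σ =>
    eventually_mem_openCone_iff s σ x u).and (hu.eventually_add_smul x)).exists
  simp only [← hε]
  obtain ⟨σ, hσ, hy⟩ := exists_mem_openCone hc h0 hgen
  exact ⟨σ, ⟨hσ, hy⟩, fun τ hτ => eq_of_mem_openCone hc hτ.1 hσ hτ.2 hy⟩

theorem mem_convexHull_iff_sum_coord_le_one {s : Fin n → Fin 3 → ℝ} {c : Fin n → ℝ}
    (hc : IsGenericCost s c) (h0 : (0 : Fin 3 → ℝ) ∈ convexHull ℝ (range s))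
    {σ : Fin 3 ↪o Fin n} (hσ : σ ∈ cells s c) {y : Fin 3 → ℝ}
    (hy : ∀ i, 0 ≤ coord (rows s σ) y i) :
    y ∈ convexHull ℝ (range s) ↔ ∑ i, coord (rows s σ) y i ≤ 1 := by
  constructor
  · intro hyQ
    let m : (Fin 3 → ℝ) →ₗ[ℝ] ℝ := (∑ i, LinearMap.proj i) ∘ₗ coord (rows s σ)
    have hm : ∀ z, m z = ∑ i, coord (rows s σ) z i := fun z => by simp [m]
    have hsub : convexHull ℝ (range s) ⊆ {z | m z ≤ 1} := by
      refine convexHull_min ?_ (convex_halfSpace_le m.isLinear 1)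
      rintro _ ⟨j, rfl⟩
      rw [mem_ofPred_eq, hm]
      exact sum_coord_le_one hc hσ j
    rw [← hm]
    exact hsub hyQ
  · intro hle
    have := (convex_convexHull ℝ (range s)).sum_mem (t := Finset.univ)
      (w := (Fin.cons (1 - ∑ i, coord (rows s σ) y i) (coord (rows s σ) y) : Fin 4 → ℝ))
      (z := (Fin.cons 0 (fun i => s (σ i)) : Fin 4 → Fin 3 → ℝ))
      (fun i _ => by
        refine Fin.cases ?_ (fun i => ?_) i
        · simpa using hle
        · simpa using hy i)
      (by rw [Fin.sum_univ_succ]; simp)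
      (fun i _ => by
        refine Fin.cases ?_ (fun i => ?_) i
        · simpa using h0
        · simpa using subset_convexHull ℝ (range s) ⟨σ i, rfl⟩)
    rw [Fin.sum_univ_succ] at this
    simp only [Fin.cons_zero, Fin.cons_succ, smul_zero, zero_add] at this
    convert this
    exact (sum_coord_smul hσ.1 y).symm

open Classical in
theorem volume_convexHull_mul_six {s : Fin n → Fin 3 → ℝ} {c : Fin n → ℝ}
    (hc : IsGenericCost s c) (h0 : (0 : Fin 3 → ℝ) ∈ interior (convexHull ℝ (range s))) :
    volume (convexHull ℝ (range s)) * 6 =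
      ∑ σ with σ ∈ cells s c, ENNReal.ofReal |(rows s σ).det| := by
  have hae : convexHull ℝ (range s) =ᵐ[volume]
      ⋃ σ ∈ Finset.univ.filter (· ∈ cells s c), coord (rows s σ) ⁻¹' cornerSimplex := by
    filter_upwards [ae_isGenericVector s] with y hy
    refine propext ⟨fun hyQ => ?_, fun h => ?_⟩
    · obtain ⟨σ, hσ, hyσ⟩ := exists_mem_openCone hc h0 hy
      refine mem_iUnion₂.2 ⟨σ, by simpa using hσ, hyσ, ?_⟩
      exact (mem_convexHull_iff_sum_coord_le_one hc (interior_subset h0) hσ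
        fun i => (hyσ i).le).1 hyQ
    · obtain ⟨σ, hσ, hpos, hle⟩ := mem_iUnion₂.1 h
      exact (mem_convexHull_iff_sum_coord_le_one hc (interior_subset h0) (by simpa using hσ)
        fun i => (hpos i).le).2 hle
  rw [measure_congr hae, measure_biUnion_finset]
  · rw [Finset.sum_mul]
    refine Finset.sum_congr rfl fun σ hσ => ?_
    have hσ : σ ∈ cells s c := by simpa using hσ
    exact volume_coord_preimage_cornerSimplex hσ.1
  · intro σ hσ τ hτ hne
    refine Set.disjoint_left.2 fun y h1 h2 => hne ?_
    exact eq_of_mem_openCone hc (by simpa using hσ) (by simpa using hτ) h1.1 h2.1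
  · exact fun σ _ => (coord (rows s σ)).continuous_of_finiteDimensional.measurable
      measurableSet_cornerSimplex

theorem exists_isGenericVector (s : Fin n → Fin 3 → ℝ) : ∃ u, IsGenericVector s u :=
  (ae_isGenericVector s).exists

/-- Nonzero lattice points of the convex hull of `s`. -/
def nonzeroPts (s : Fin n → Fin 3 → ℤ) : Set (Fin 3 → ℤ) :=
  {x | toReal x ∈ convexHull ℝ (range fun j => toReal (s j)) ∧ x ≠ 0}

theorem LexPos.coord_nonneg {M : Matrix (Fin 3) (Fin 3) ℝ} {α y : Fin 3 → ℝ} (h : LexPos M α y)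
    (i : Fin 3) : 0 ≤ coord M y i :=
  (h i).elim le_of_lt fun h => h.1.ge

theorem heightOne_eq {s : Fin n → Fin 3 → ℤ} {c : Fin n → ℝ}
    (hc : IsGenericCost (fun j => toReal (s j)) c)
    (h0 : (0 : Fin 3 → ℝ) ∈ convexHull ℝ (range fun j => toReal (s j)))
    {σ : Fin 3 ↪o Fin n} (hσ : σ ∈ cells (fun j => toReal (s j)) c)
    (h_integral : ∀ x : Fin 3 → ℤ, ∃ z : ℤ, ∑ i, coord (toRealMatrix (rows s σ)) (toReal x) i = z)
    (α : Fin 3 → ℝ) :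
    heightOne (rows s σ) α =
      {x ∈ nonzeroPts s | LexPos (toRealMatrix (rows s σ)) α (toReal x)} := by
  have hdet : (toRealMatrix (rows s σ)).det ≠ 0 := hσ.1
  ext x
  constructor
  · rintro ⟨hx, h1⟩
    refine ⟨⟨(mem_convexHull_iff_sum_coord_le_one hc h0 hσ hx.coord_nonneg).2 h1.le, ?_⟩, hx⟩
    rintro rfl
    simp at h1
  · rintro ⟨⟨hxQ, hx0⟩, hx⟩
    refine ⟨hx, ?_⟩
    have hle := (mem_convexHull_iff_sum_coord_le_one hc h0 hσ hx.coord_nonneg).1 hxQ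
    have hpos : 0 < ∑ i, coord (toRealMatrix (rows s σ)) (toReal x) i := by
      refine (Finset.sum_nonneg fun i _ => hx.coord_nonneg i).lt_of_ne fun hz => hx0 ?_
      have hz := (Finset.sum_eq_zero_iff_of_nonneg fun i _ => hx.coord_nonneg i).1 hz.symm
      refine toReal_injective (coord_injective hdet ?_)
      rw [toReal_zero, map_zero]
      exact funext fun i => hz i (Finset.mem_univ i)
    obtain ⟨z, hz⟩ := h_integral x
    change ∑ i, coord (toRealMatrix (rows s σ)) (toReal x) i ≤ 1 at hle
    rw [hz] at hpos hle ⊢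
    have h1 : 0 < z := by exact_mod_cast hpos
    have h2 : z ≤ 1 := by exact_mod_cast hle
    have : z = 1 := by omega
    simp [this]

open Classical in
theorem sum_ncard_heightOne {s : Fin n → Fin 3 → ℤ} {c : Fin n → ℝ}
    (hc : IsGenericCost (fun j => toReal (s j)) c)
    (h0 : (0 : Fin 3 → ℝ) ∈ interior (convexHull ℝ (range fun j => toReal (s j))))
    (h_integral : ∀ σ ∈ cells (fun j => toReal (s j)) c, ∀ x : Fin 3 → ℤ, ∃ z : ℤ,
      ∑ i, coord (toRealMatrix (rows s σ)) (toReal x) i = z)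
    {u : Fin 3 → ℝ} (hu : IsGenericVector (fun j => toReal (s j)) u) :
    (nonzeroPts s).Finite ∧ ∑ σ with σ ∈ cells (fun j => toReal (s j)) c,
      (heightOne (rows s σ) (coord (toRealMatrix (rows s σ)) u)).ncard = (nonzeroPts s).ncard := by
  set T := Finset.univ.filter (· ∈ cells (fun j => toReal (s j)) c) with hT
  have hmem : ∀ {σ}, σ ∈ T ↔ σ ∈ cells (fun j => toReal (s j)) c := by simp [hT]
  set H : (Fin 3 ↪o Fin n) → Set (Fin 3 → ℤ) :=
    fun σ => heightOne (rows s σ) (coord (toRealMatrix (rows s σ)) u) with hH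
  have hHeq : ∀ σ ∈ T, H σ = {x ∈ nonzeroPts s |
      LexPos (toRealMatrix (rows s σ)) (coord (toRealMatrix (rows s σ)) u) (toReal x)} :=
    fun σ hσ => heightOne_eq hc (interior_subset h0) (hmem.1 hσ) (h_integral σ (hmem.1 hσ)) _
  have hfin : ∀ σ ∈ T, (H σ).Finite := fun σ hσ => finite_heightOne (fun h => by
    have : (toRealMatrix (rows s σ)).det ≠ 0 := (hmem.1 hσ).1
    rw [det_toRealMatrix, h] at this
    simp at this) _
  have hex := fun x : Fin 3 → ℤ => existsUnique_lexPos hc h0 hu (toReal x)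
  have hunion : nonzeroPts s = ⋃ σ ∈ T, H σ := by
    ext x
    simp only [mem_iUnion]
    constructor
    · intro hx
      obtain ⟨σ, ⟨hσ, hxσ⟩, -⟩ := hex x
      exact ⟨σ, hmem.2 hσ, by rw [hHeq σ (hmem.2 hσ)]; exact ⟨hx, hxσ⟩⟩
    · rintro ⟨σ, hσ, hx⟩
      rw [hHeq σ hσ] at hx
      exact hx.1
  have hBfin : (nonzeroPts s).Finite := by
    rw [hunion]
    exact T.finite_toSet.biUnion hfin
  refine ⟨hBfin, ?_⟩
  have hdisj : (T : Set (Fin 3 ↪o Fin n)).PairwiseDisjoint H := fun σ hσ τ hτ hne =>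
    Set.disjoint_left.2 fun x h1 h2 => hne <| by
      rw [hHeq σ hσ] at h1
      rw [hHeq τ hτ] at h2
      exact (hex x).unique ⟨hmem.1 hσ, h1.2⟩ ⟨hmem.1 hτ, h2.2⟩
  rw [hunion]
  have h3 := T.finite_toSet.ncard_biUnion hfin hdisj
  rw [finsum_mem_coe_finset] at h3
  exact h3.symm

open Classical in
theorem sum_ite_mem_openCone {s : Fin n → Fin 3 → ℝ} {c : Fin n → ℝ} (hc : IsGenericCost s c)
    (h0 : (0 : Fin 3 → ℝ) ∈ interior (convexHull ℝ (range s))) {u : Fin 3 → ℝ}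
    (hu : IsGenericVector s u) (k : ℕ) :
    ∑ σ with σ ∈ cells s c, (if u ∈ openCone s σ then k else 0) = k := by
  obtain ⟨σ, hσ, hyσ⟩ := exists_mem_openCone hc h0 hu
  rw [Finset.sum_eq_single_of_mem σ (by simpa using hσ), if_pos hyσ]
  intro τ hτ hne
  exact if_neg fun h => hne (eq_of_mem_openCone hc (by simpa using hτ) hσ h hyσ)

theorem volume_convexHull_add_four {s : Fin n → Fin 3 → ℤ}
    (h0 : (0 : Fin 3 → ℝ) ∈ interior (convexHull ℝ (range fun j => toReal (s j))))
    (h_integral : ∀ (m : (Fin 3 → ℝ) →ₗ[ℝ] ℝ) (σ : Fin 3 ↪o Fin n),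
      (rows (fun j => toReal (s j)) σ).det ≠ 0 → (∀ i, m (toReal (s (σ i))) = 1) →
      (∀ j, m (toReal (s j)) ≤ 1) → ∀ x : Fin 3 → ℤ, ∃ z : ℤ, m (toReal x) = z) :
    (nonzeroPts s).Finite ∧ ∃ V : ℕ,
      volume (convexHull ℝ (range fun j => toReal (s j))) * 6 = V ∧
      V + 4 = 2 * (nonzeroPts s).ncard := by
  classical
  set r : Fin n → Fin 3 → ℝ := fun j => toReal (s j) with hr
  obtain ⟨c, hc⟩ := exists_isGenericCost r
  obtain ⟨u, hu⟩ := exists_isGenericVector r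
  have h_integral_cell : ∀ σ ∈ cells r c, ∀ x : Fin 3 → ℤ, ∃ z : ℤ,
      ∑ i, coord (toRealMatrix (rows s σ)) (toReal x) i = z := fun σ hσ x => by
    have h1 : ∀ y, interp (fun _ => 1) r σ y = ∑ i, coord (rows r σ) y i := fun y => by
      simp [interp_apply]
    obtain ⟨z, hz⟩ := h_integral (interp (fun _ => 1) r σ) σ hσ.1 (interp_vertex hσ.1 _)
      (fun j => by rw [h1]; exact sum_coord_le_one hc hσ j) x
    exact ⟨z, by rw [← hz, h1]; rfl⟩
  have hdet : ∀ σ ∈ cells r c, (rows s σ).det ≠ 0 := fun σ hσ h => by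
    have : (toRealMatrix (rows s σ)).det ≠ 0 := hσ.1
    rw [det_toRealMatrix, h] at this
    simp at this
  obtain ⟨hfin, h1⟩ := sum_ncard_heightOne hc h0 h_integral_cell hu
  obtain ⟨-, h2⟩ := sum_ncard_heightOne hc h0 h_integral_cell hu.neg
  refine ⟨hfin, ∑ σ with σ ∈ cells r c, (rows s σ).det.natAbs, ?_, ?_⟩
  · rw [volume_convexHull_mul_six hc h0]
    push_cast
    refine Finset.sum_congr rfl fun σ _ => ?_
    have : (rows r σ).det = ((rows s σ).det : ℝ) := det_toRealMatrix _
    rw [this, ← Int.cast_abs, Int.abs_eq_natAbs, Int.cast_natCast, ENNReal.ofReal_natCast]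
  · have h3 := sum_ite_mem_openCone hc h0 hu 2
    have h4 := sum_ite_mem_openCone hc h0 hu.neg 2
    have key : ∀ σ ∈ Finset.univ.filter (· ∈ cells r c),
        (heightOne (rows s σ) (coord (toRealMatrix (rows s σ)) u)).ncard +
          (heightOne (rows s σ) (coord (toRealMatrix (rows s σ)) (-u))).ncard =
        (rows s σ).det.natAbs +
          ((if u ∈ openCone r σ then 2 else 0) + (if -u ∈ openCone r σ then 2 else 0)) := by
      intro σ hσ
      have hσ : σ ∈ cells r c := by simpa using hσ
      have := ncard_heightOne_add (hdet σ hσ) (α := coord (toRealMatrix (rows s σ)) u)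
        (fun i => hu.coord_ne_zero hσ.1 i) (h_integral_cell σ hσ)
      rw [map_neg, this, ← map_neg]
      exact congrArg _ (congrArg₂ _ (if_congr Iff.rfl rfl rfl) (if_congr Iff.rfl rfl rfl))
    have h5 := Finset.sum_congr rfl key
    simp only [Finset.sum_add_distrib] at h5
    rw [← hr] at h1 h2
    omega

end Count

theorem dotp_add {k : ℕ} (a x y : Fin k → ℝ) : dotp a (x + y) = dotp a x + dotp a y :=
  dotProduct_add a x y

theorem toReal_mem_latticePts (x : Fin 3 → ℤ) : toReal x ∈ latticePts := fun i => ⟨x i, rfl⟩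

theorem exists_toReal_eq {x : Fin 3 → ℝ} (hx : x ∈ latticePts) : ∃ z, toReal z = x := by
  choose z hz using hx
  exact ⟨z, funext fun i => (hz i).symm⟩

theorem finrank_direction_eq_two {F : Set (Fin 3 → ℝ)} {m : (Fin 3 → ℝ) →ₗ[ℝ] ℝ}
    {M : Matrix (Fin 3) (Fin 3) ℝ} (hM : M.det ≠ 0) (hm : ∀ i, m (M i) = 1) {q : Fin 3 → ℝ}
    (hMF : ∀ i, q + M i ∈ F) (hF : ∀ x ∈ F, m x = m q + 1) :
    Module.finrank ℝ (affineSpan ℝ F).direction = 2 := by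
  set D := (affineSpan ℝ F).direction with hD
  have hDm : D ≤ LinearMap.ker m := by
    rw [hD, direction_affineSpan, vectorSpan_def, Submodule.span_le]
    rintro _ ⟨x, hx, y, hy, rfl⟩
    simp [hF x hx, hF y hy]
  have hlt : Module.finrank ℝ D < 3 := by
    have := Submodule.finrank_lt (s := D) fun htop => by
      have h1 := hDm (htop ▸ Submodule.mem_top : M 0 ∈ D)
      rw [LinearMap.mem_ker, hm] at h1
      exact one_ne_zero h1
    simpa using this
  have hsup : D ⊔ Submodule.span ℝ {M 0} = ⊤ := by
    refine eq_top_iff.2 fun y _ => ?_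
    rw [← sum_coord_smul hM y]
    refine Submodule.sum_mem _ fun i _ => Submodule.smul_mem _ _ ?_
    rw [← sub_add_cancel (M i) (M 0)]
    refine Submodule.add_mem_sup ?_ (Submodule.mem_span_singleton_self _)
    have := AffineSubspace.vsub_mem_direction (subset_affineSpan ℝ F (hMF i))
      (subset_affineSpan ℝ F (hMF 0))
    simpa using this
  have hle := Submodule.finrank_add_le_finrank_add_finrank D (Submodule.span ℝ {M 0})
  have h1 := finrank_span_le_card (R := ℝ) ({M 0} : Set (Fin 3 → ℝ))
  rw [hsup, finrank_top, Module.finrank_fin_fun] at hle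
  simp only [toFinset_singleton, Finset.card_singleton] at h1
  omega

theorem isIntegral_of_isReflexive {P : Set (Fin 3 → ℝ)} {p : Fin 3 → ℝ} (hrefl : IsReflexive P p)
    {m : (Fin 3 → ℝ) →ₗ[ℝ] ℝ} {M : Matrix (Fin 3) (Fin 3) ℝ} (hM : M.det ≠ 0)
    (hm : ∀ i, m (M i) = 1) (hMP : ∀ i, p + M i ∈ P) (hP : ∀ x ∈ P, m x ≤ m p + 1)
    (x : Fin 3 → ℤ) : ∃ z : ℤ, m (toReal x) = z := by
  have hdot : ∀ y, dotp (fun i => -m (Pi.single i 1)) y = -m y := fun y => by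
    conv_rhs => rw [pi_eq_sum_univ' y]
    simp [dotp, mul_comm]
  set F := P ∩ {y | dotp (fun i => -m (Pi.single i 1)) y = -(m p + 1)} with hFdef
  have hMF : ∀ i, p + M i ∈ F := fun i => ⟨hMP i, by simp [hdot, hm]⟩
  obtain ⟨a, b, hab, -, hap⟩ := hrefl F ⟨_, -(m p + 1),
    fun y hy => by rw [hdot]; exact neg_le_neg (hP y hy), hFdef,
    finrank_direction_eq_two hM hm hMF fun y hy => neg_injective ((hdot y).symm.trans hy.2)⟩
  have haM : ∀ i, dotp (fun i => (a i : ℝ)) (M i) = -1 := fun i => by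
    have := hab _ (hMF i)
    rw [dotp_add, hap] at this
    linarith
  refine ⟨-∑ i, a i * x i, ?_⟩
  have : m (toReal x) = -dotp (fun i => (a i : ℝ)) (toReal x) := by
    rw [← sum_coord_smul hM (toReal x), map_sum]
    have hsum : dotp (fun i => (a i : ℝ)) (∑ i, coord M (toReal x) i • M i) =
        ∑ i, coord M (toReal x) i * dotp (fun i => (a i : ℝ)) (M i) := by
      change dotProduct _ _ = _
      rw [dotProduct_sum]
      exact Finset.sum_congr rfl fun i _ => dotProduct_smul _ _ _
    rw [hsum]
    simp [haM, hm]
  rw [this]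
  simp [dotp, toReal]

end LatticeCone

open LatticeCone

theorem stmt8 (P : Set (Fin 3 → ℝ)) (p : Fin 3 → ℝ)
    (hP : IsCanonicalPoly P p) (hrefl : IsReflexive P p) :
    (frontier P ∩ latticePts).Finite ∧
    volume P * 6 + 4 = 2 * ((frontier P ∩ latticePts).ncard : ENNReal) ∧
    ∃ V : ℕ, Even V ∧ volume P * 6 = (V : ENNReal) := by
  obtain ⟨⟨F, hFfin, hFlat, hPF⟩, hp, h_integral⟩ := hP
  obtain ⟨n, t, -, ht⟩ := hFfin.fin_param
  have htF : ∀ j, t j ∈ F := fun j => ht ▸ mem_range_self j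
  choose s' hs' using fun j => exists_toReal_eq (hFlat (htF j))
  obtain ⟨q, rfl⟩ := exists_toReal_eq hp
  set s : Fin n → Fin 3 → ℤ := fun j => s' j - q with hs
  have hst : ∀ j, toReal (s j) = -toReal q + t j := fun j => by
    rw [hs, toReal_sub, hs', sub_eq_neg_add]
  have hQ : convexHull ℝ (range fun j => toReal (s j)) = (fun y => toReal q + y) ⁻¹' P := by
    have h1 := ((AffineEquiv.constVAdd ℝ (Fin 3 → ℝ) (-toReal q)) :
      (Fin 3 → ℝ) →ᵃ[ℝ] (Fin 3 → ℝ)).image_convexHull F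
    have h2 : (range fun j => toReal (s j)) =
        (AffineEquiv.constVAdd ℝ (Fin 3 → ℝ) (-toReal q)) '' F := by
      rw [← ht, ← range_comp]
      exact congrArg range (funext hst)
    have h3 : (fun y => -toReal q + y) '' P = (fun y => toReal q + y) ⁻¹' P := by
      rw [image_add_left, neg_neg]
    rw [h2, ← h3, hPF]
    exact h1.symm
  have hqP : toReal q ∈ interior P :=
    (h_integral.symm ▸ mem_singleton _ : toReal q ∈ interior P ∩ _).1
  have h0 : (0 : Fin 3 → ℝ) ∈ interior (convexHull ℝ (range fun j => toReal (s j))) := by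
    rw [hQ]
    have := (Homeomorph.addLeft (toReal q)).preimage_interior P
    change (0 : Fin 3 → ℝ) ∈ interior (Homeomorph.addLeft (toReal q) ⁻¹' P)
    rw [← this]
    simpa using hqP
  have htP : ∀ j, toReal q + toReal (s j) ∈ P := fun j => by
    have : toReal (s j) ∈ convexHull ℝ (range fun j => toReal (s j)) :=
      subset_convexHull ℝ _ ⟨j, rfl⟩
    rwa [hQ] at this
  obtain ⟨hfin, V, hV, hV4⟩ := volume_convexHull_add_four h0 fun m σ hσ hm hle =>
    isIntegral_of_isReflexive hrefl hσ hm (fun i => htP (σ i)) fun x hx => by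
      have hsub : convexHull ℝ (range fun j => toReal (s j)) ⊆ {z | m z ≤ 1} := by
        refine convexHull_min ?_ (convex_halfSpace_le m.isLinear 1)
        rintro _ ⟨j, rfl⟩
        exact hle j
      have h1 : x - toReal q ∈ convexHull ℝ (range fun j => toReal (s j)) := by
        rw [hQ]
        simpa using hx
      have h2 : m (x - toReal q) ≤ 1 := hsub h1
      rw [map_sub] at h2
      linarith
  rw [hQ, measure_preimage_add] at hV
  have hclosed : IsClosed P := by
    rw [hPF]
    exact (hFfin.isCompact_convexHull ℝ).isClosed
  have himage : frontier P ∩ latticePts = (fun x => toReal q + toReal x) '' nonzeroPts s := by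
    ext x
    rw [hclosed.frontier_eq]
    constructor
    · rintro ⟨⟨hxP, hxi⟩, hx⟩
      obtain ⟨z, rfl⟩ := exists_toReal_eq hx
      refine ⟨z - q, ⟨?_, fun h => ?_⟩, by simp⟩
      · rw [hQ]
        simpa using hxP
      · rw [sub_eq_zero.1 h] at hxi
        exact hxi hqP
    · rintro ⟨z, ⟨hz, hz0⟩, rfl⟩
      rw [hQ] at hz
      have hlat : toReal q + toReal z ∈ latticePts := by
        rw [← toReal_add]
        exact toReal_mem_latticePts _
      refine ⟨⟨hz, fun hi => hz0 ?_⟩, hlat⟩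
      have : toReal q + toReal z ∈ ({toReal q} : Set (Fin 3 → ℝ)) := h_integral ▸ ⟨hi, hlat⟩
      exact toReal_injective (by simpa using this)
  have hinj : Function.Injective fun x : Fin 3 → ℤ => toReal q + toReal x :=
    (add_right_injective _).comp toReal_injective
  rw [himage, ncard_image_of_injective _ hinj]
  exact ⟨hfin.image _, by rw [hV]; exact_mod_cast hV4, V, by rw [Nat.even_iff]; omega, hV⟩
end
end

section
/- Let P ⊆ ℝ³ be a 3-dimensional canonical lattice polytope with interior lattice point p, set A = P ∩ ℤ³, and let T be a fine central unimodular triangulation of P induced by a weight function w : A → ℝ (i.e., w is a regularity certificate for T). Define Q = {x ∈ ℝ³ : w(p) + ⟨p,x⟩ ≤ w(v) + ⟨v,x⟩ for all v ∈ A}. Then: (i) for every tetrahedron S ∈ T, with vertex set {p, u, v, t}, there is a unique point x_S ∈ ℝ³ satisfying w(p) + ⟨p,x_S⟩ = w(u) + ⟨u,x_S⟩ = w(v) + ⟨v,x_S⟩ = w(t) + ⟨t,x_S⟩; (ii) the set of q ∈ A with w(q) + ⟨q,x_S⟩ = w(p) + ⟨p,x_S⟩ is exactly {p, u, v, t}; and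 (iii) the map S ↦ x_S is a bijection from the set of tetrahedra of T onto the set of extreme points of Q. In particular, the number of extreme points of Q equals the normalized volume of P. -/
open Set MeasureTheory

noncomputable section

/-- `T` is a triangulation of `P`: a finite collection of simplices (given by their
vertex sets, which are affinely independent sets of lattice points of `P`) whose union
is `P`, closed under taking faces, any two meeting in a common face. -/
def IsTriangulationOf (P : Set (Fin 3 → ℝ)) (T : Set (Finset (Fin 3 → ℝ))) : Prop :=
  T.Finite ∧
  (∀ S ∈ T, (S : Set (Fin 3 → ℝ)) ⊆ P ∩ latticePts ∧
    AffineIndependent ℝ (fun v : (S : Set (Fin 3 → ℝ)) => (v : Fin 3 → ℝ))) ∧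
  (⋃ S ∈ T, convexHull ℝ (S : Set (Fin 3 → ℝ))) = P ∧
  (∀ S ∈ T, ∀ S' : Finset (Fin 3 → ℝ), S' ⊆ S → S' ∈ T) ∧
  (∀ S ∈ T, ∀ S' ∈ T, ∃ F : Finset (Fin 3 → ℝ), F ∈ T ∧ F ⊆ S ∧ F ⊆ S' ∧
    convexHull ℝ (S : Set (Fin 3 → ℝ)) ∩ convexHull ℝ (S' : Set (Fin 3 → ℝ)) =
      convexHull ℝ (F : Set (Fin 3 → ℝ)))

/-- `T` is central: every `3`-simplex of `T` contains `p`. -/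
def IsCentral (p : Fin 3 → ℝ) (T : Set (Finset (Fin 3 → ℝ))) : Prop :=
  ∀ S ∈ T, S.card = 4 → p ∈ convexHull ℝ (S : Set (Fin 3 → ℝ))

/-- `T` is unimodular: every `3`-simplex of `T` has Euclidean volume `1/6`. -/
def IsUnimodular (T : Set (Finset (Fin 3 → ℝ))) : Prop :=
  ∀ S ∈ T, S.card = 4 →
    volume (convexHull ℝ (S : Set (Fin 3 → ℝ))) = ENNReal.ofReal (1 / 6)

/-- `T` is fine: every lattice point of `P` is a vertex of a simplex of `T`. -/
def IsFine (P : Set (Fin 3 → ℝ)) (T : Set (Finset (Fin 3 → ℝ))) : Prop :=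
  ∀ x ∈ P ∩ latticePts, ∃ S ∈ T, x ∈ S

/-- The weight function `w` induces the triangulation `T` of `P`
(it is a regularity certificate for `T`). -/
def Induces (P : Set (Fin 3 → ℝ)) (T : Set (Finset (Fin 3 → ℝ))) (w : (Fin 3 → ℝ) → ℝ) :
    Prop :=
  ∀ S ∈ T, S.card = 4 → ∃ ℓ : (Fin 3 → ℝ) →ᵃ[ℝ] ℝ,
    (∀ v ∈ S, ℓ v = w v) ∧ ∀ v ∈ P ∩ latticePts, v ∉ S → ℓ v < w v

/-- `T` is a regular triangulation of `P`. -/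
def IsRegularTriang (P : Set (Fin 3 → ℝ)) (T : Set (Finset (Fin 3 → ℝ))) : Prop :=
  ∃ w : (Fin 3 → ℝ) → ℝ, Induces P T w

/-- The region `Q = {x : w(p) + ⟨p,x⟩ ≤ w(v) + ⟨v,x⟩ for all v ∈ A}`. -/
def tropRegion (A : Set (Fin 3 → ℝ)) (w : (Fin 3 → ℝ) → ℝ) (p : Fin 3 → ℝ) :
    Set (Fin 3 → ℝ) :=
  {x | ∀ v ∈ A, w p + dotp p x ≤ w v + dotp v x}

/-- The linear functional `v ↦ ⟨v, d⟩`. -/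
def dotpLin (d : Fin 3 → ℝ) : (Fin 3 → ℝ) →ₗ[ℝ] ℝ where
  toFun v := dotp v d
  map_add' u v := by simp [dotp, add_mul, Finset.sum_add_distrib]
  map_smul' c v := by simp [dotp, Finset.mul_sum, mul_assoc]

lemma dotpLin_apply (d v : Fin 3 → ℝ) : dotpLin d v = dotp v d := rfl

lemma dotp_add_smul (v x d : Fin 3 → ℝ) (c : ℝ) : dotp v (x + c • d) = dotp v x + c * dotp v d := by
  simp only [dotp, Fin.sum_univ_three, Pi.add_apply, Pi.smul_apply, smul_eq_mul]
  ring

lemma dotp_convex_comb (v x y : Fin 3 → ℝ) (a b : ℝ) :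
    dotp v (a • x + b • y) = a * dotp v x + b * dotp v y := by
  simp only [dotp, Fin.sum_univ_three, Pi.add_apply, Pi.smul_apply, smul_eq_mul]
  ring

lemma dotpLin_injective : Function.Injective dotpLin := by
  intro x y h
  ext i
  have := LinearMap.congr_fun h (Pi.single i 1)
  simpa [dotpLin_apply, dotp, Pi.single_apply] using this

lemma exists_eq_dotpLin (f : (Fin 3 → ℝ) →ₗ[ℝ] ℝ) : ∃ d, f = dotpLin d := by
  refine ⟨fun i => f (Pi.single i 1), LinearMap.pi_ext' fun i => LinearMap.ext_ring ?_⟩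
  simp [dotpLin_apply, dotp, Pi.single_apply]

/-- A set that spans `ℝ³` affinely separates points up to an additive constant. -/
lemma eq_of_dotp_sub_eq {s : Set (Fin 3 → ℝ)} (hs : affineSpan ℝ s = ⊤) {x y : Fin 3 → ℝ} {c : ℝ}
    (h : ∀ v ∈ s, dotp v x = dotp v y + c) : x = y := by
  have key : (dotpLin x).toAffineMap = (dotpLin y).toAffineMap + AffineMap.const ℝ _ c :=
    AffineMap.ext_on hs fun v hv => by simpa [dotpLin_apply] using h v hv
  have := congrArg AffineMap.linear key
  exact dotpLin_injective (by simpa using this)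

lemma volume_convexHull_eq_zero {s : Set (Fin 3 → ℝ)} (hs : affineSpan ℝ s ≠ ⊤) :
    volume (convexHull ℝ s) = 0 :=
  measure_mono_null (convexHull_subset_affineSpan s) (Measure.addHaar_affineSubspace _ _ hs)

lemma affineSpan_eq_top_iff_card {S : Finset (Fin 3 → ℝ)}
    (h : AffineIndependent ℝ (fun v : (S : Set (Fin 3 → ℝ)) => (v : Fin 3 → ℝ))) :
    affineSpan ℝ (S : Set (Fin 3 → ℝ)) = ⊤ ↔ S.card = 4 := by
  have := h.affineSpan_eq_top_iff_card_eq_finrank_add_one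
  simpa using this

/-- The constraints tight at an extreme point of a polyhedron cut out by finitely many
inequalities `w p + ⟨p, x⟩ ≤ w v + ⟨v, x⟩` span the whole space. -/
lemma affineSpan_tight_eq_top {A : Set (Fin 3 → ℝ)} (hA : A.Finite) {w : (Fin 3 → ℝ) → ℝ}
    {p x : Fin 3 → ℝ} (hp : p ∈ A) (hx : x ∈ extremePoints ℝ (tropRegion A w p)) :
    affineSpan ℝ {v | v ∈ A ∧ w v + dotp v x = w p + dotp p x} = ⊤ := by
  set B := {v | v ∈ A ∧ w v + dotp v x = w p + dotp p x} with hB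
  have hpB : p ∈ B := ⟨hp, rfl⟩
  rw [AffineSubspace.affineSpan_eq_top_iff_vectorSpan_eq_top_of_nonempty ℝ _ _ ⟨p, hpB⟩]
  by_contra hne
  obtain ⟨f, hf0, hf⟩ := Submodule.exists_le_ker_of_lt_top _ (lt_top_iff_ne_top.2 hne)
  obtain ⟨d, rfl⟩ := exists_eq_dotpLin f
  have hd : d ≠ 0 := by
    rintro rfl
    exact hf0 (LinearMap.ext fun v => by simp [dotpLin_apply, dotp])
  have hconst : ∀ v ∈ B, dotp v d = dotp p d := fun v hv => by
    have := hf (vsub_mem_vectorSpan ℝ hv hpB)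
    rw [LinearMap.mem_ker, vsub_eq_sub, map_sub, dotpLin_apply, dotpLin_apply] at this
    linarith
  have hev : ∀ᶠ ε : ℝ in nhds 0, ∀ v ∈ A, v ∉ B →
      ε * |dotp v d - dotp p d| < w v + dotp v x - (w p + dotp p x) := by
    rw [Filter.eventually_all_finite hA]
    intro v hv
    by_cases hvB : v ∈ B
    · simp [hvB]
    · have hpos : 0 < w v + dotp v x - (w p + dotp p x) :=
        sub_pos.2 (lt_of_le_of_ne (hx.1 v hv) fun h => hvB ⟨hv, h.symm⟩)
      have hc : Continuous fun ε : ℝ => ε * |dotp v d - dotp p d| := by fun_prop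
      have hnear := hc.continuousAt.eventually_lt (continuousAt_const (x := (0 : ℝ)))
        (show (0 : ℝ) * |dotp v d - dotp p d| < w v + dotp v x - (w p + dotp p x) by
          rwa [zero_mul])
      filter_upwards [hnear] with ε hε _ using hε
  obtain ⟨ε, hε, hε0⟩ := ((hev.filter_mono nhdsWithin_le_nhds).and
    (self_mem_nhdsWithin (s := Ioi (0 : ℝ)))).exists
  have hmem : ∀ c : ℝ, |c| = ε → x + c • d ∈ tropRegion A w p := by
    intro c hc v hv
    rw [dotp_add_smul, dotp_add_smul]
    by_cases hvB : v ∈ B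
    · rw [hconst v hvB]
      linarith [hx.1 v hv]
    · have h1 := hε v hv hvB
      rw [← hc, ← abs_mul] at h1
      linarith [neg_abs_le (c * (dotp v d - dotp p d))]
  have hε' : (0 : ℝ) < ε := hε0
  have hseg : x ∈ openSegment ℝ (x + ε • d) (x + (-ε) • d) :=
    ⟨1 / 2, 1 / 2, by norm_num, by norm_num, by norm_num, by module⟩
  have h := hx.2 (hmem ε (abs_of_pos hε')) (hmem (-ε) (by rw [abs_neg, abs_of_pos hε'])) hseg
  rw [add_eq_left, smul_eq_zero] at h
  exact h.elim hε'.ne' hd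

section Triangulation

variable {P : Set (Fin 3 → ℝ)} {T : Set (Finset (Fin 3 → ℝ))}

lemma IsTriangulationOf.volume_inter_eq_zero (hT : IsTriangulationOf P T)
    {S S' : Finset (Fin 3 → ℝ)} (hS : S ∈ T) (hS' : S' ∈ T) (hc : S.card = 4) (hc' : S'.card = 4)
    (hne : S ≠ S') :
    volume (convexHull ℝ (S : Set (Fin 3 → ℝ)) ∩ convexHull ℝ (S' : Set (Fin 3 → ℝ))) = 0 := by
  obtain ⟨F, hF, hFS, hFS', hEq⟩ := hT.2.2.2.2 S hS S' hS'
  rw [hEq]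
  refine volume_convexHull_eq_zero fun htop => hne ?_
  have hFc := (affineSpan_eq_top_iff_card (hT.2.1 F hF).2).1 htop
  rw [← Finset.eq_of_subset_of_card_le hFS (by omega),
    ← Finset.eq_of_subset_of_card_le hFS' (by omega)]

/-- The tetrahedra of a triangulation cover the polytope up to a null set. -/
lemma IsTriangulationOf.volume_diff_eq_zero (hT : IsTriangulationOf P T) :
    volume (P \ ⋃ S ∈ {S | S ∈ T ∧ S.card = 4}, convexHull ℝ (S : Set (Fin 3 → ℝ))) = 0 := by
  have hlow : volume (⋃ S ∈ {S | S ∈ T ∧ S.card ≠ 4}, convexHull ℝ (S : Set (Fin 3 → ℝ))) = 0 := by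
    rw [measure_biUnion_null_iff (hT.1.subset fun S hS => hS.1).countable]
    exact fun S hS => volume_convexHull_eq_zero fun h =>
      hS.2 ((affineSpan_eq_top_iff_card (hT.2.1 S hS.1).2).1 h)
  refine measure_mono_null ?_ hlow
  rintro z ⟨hz, hz'⟩
  rw [← hT.2.2.1] at hz
  simp only [mem_iUnion, mem_ofPred_eq] at hz hz' ⊢
  obtain ⟨S, hS, hzS⟩ := hz
  exact ⟨S, ⟨hS, fun hc => hz' ⟨S, ⟨hS, hc⟩, hzS⟩⟩, hzS⟩

lemma IsTriangulationOf.convexHull_subset (hT : IsTriangulationOf P T) {S : Finset (Fin 3 → ℝ)}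
    (hS : S ∈ T) : convexHull ℝ (S : Set (Fin 3 → ℝ)) ⊆ P := by
  rw [← hT.2.2.1]
  exact subset_iUnion₂_of_subset S hS subset_rfl

lemma IsTriangulationOf.volume_eq (hT : IsTriangulationOf P T) (huni : IsUnimodular T) :
    volume P * 6 = ({S | S ∈ T ∧ S.card = 4}.ncard : ENNReal) := by
  have hfin : {S | S ∈ T ∧ S.card = 4}.Finite := hT.1.subset fun S hS => hS.1
  have hunion : volume P =
      volume (⋃ S ∈ hfin.toFinset, convexHull ℝ (S : Set (Fin 3 → ℝ))) := by
    refine le_antisymm ?_ (measure_mono (iUnion₂_subset fun S hS =>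
      hT.convexHull_subset (hfin.mem_toFinset.1 hS).1))
    have h := measure_le_inter_add_sdiff volume P
      (⋃ S ∈ {S | S ∈ T ∧ S.card = 4}, convexHull ℝ (S : Set (Fin 3 → ℝ)))
    rw [hT.volume_diff_eq_zero, add_zero] at h
    refine h.trans (measure_mono (inter_subset_right.trans ?_))
    simp only [Set.Finite.mem_toFinset, subset_refl]
  have hsum : volume (⋃ S ∈ hfin.toFinset, convexHull ℝ (S : Set (Fin 3 → ℝ))) =
      ∑ S ∈ hfin.toFinset, volume (convexHull ℝ (S : Set (Fin 3 → ℝ))) := by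
    refine measure_biUnion_finset₀ ?_ fun S _ =>
      (S.finite_toSet.isClosed_convexHull (𝕜 := ℝ)).measurableSet.nullMeasurableSet
    intro S hS S' hS' hne
    rw [Finset.mem_coe, hfin.mem_toFinset] at hS hS'
    exact hT.volume_inter_eq_zero hS.1 hS'.1 hS.2 hS'.2 hne
  rw [hunion, hsum, Finset.sum_congr rfl fun S hS =>
    huni S (hfin.mem_toFinset.1 hS).1 (hfin.mem_toFinset.1 hS).2, Finset.sum_const,
    Set.ncard_eq_toFinset_card _ hfin, nsmul_eq_mul, mul_assoc,
    ← ENNReal.ofReal_ofNat 6, ← ENNReal.ofReal_mul (by norm_num)]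
  norm_num

/-- A subset of `P` spanning `ℝ³` has a convex hull that overlaps some tetrahedron of the triangulation in a
set that spans `ℝ³`. -/
lemma IsTriangulationOf.exists_affineSpan_inter_eq_top (hT : IsTriangulationOf P T)
    (hconv : Convex ℝ P) {B : Set (Fin 3 → ℝ)} (hBP : B ⊆ P) (hB : affineSpan ℝ B = ⊤) :
    ∃ S ∈ T, S.card = 4 ∧
      affineSpan ℝ (convexHull ℝ B ∩ convexHull ℝ (S : Set (Fin 3 → ℝ))) = ⊤ := by
  by_contra! hcon
  have hpos : volume (convexHull ℝ B) ≠ 0 := fun h =>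
    (isOpen_interior.measure_pos volume (interior_convexHull_nonempty_iff_affineSpan_eq_top.2 hB)).ne'
      (measure_mono_null interior_subset h)
  refine hpos ?_
  have hnull : volume (⋃ S ∈ {S | S ∈ T ∧ S.card = 4},
      convexHull ℝ B ∩ convexHull ℝ (S : Set (Fin 3 → ℝ))) = 0 := by
    rw [measure_biUnion_null_iff (hT.1.subset fun S hS => hS.1).countable]
    exact fun S hS => measure_mono_null (subset_affineSpan ℝ _)
      (Measure.addHaar_affineSubspace _ _ (hcon S hS.1 hS.2))
  refine measure_mono_null ?_ (measure_union_null hT.volume_diff_eq_zero hnull)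
  intro z hz
  have hzP : z ∈ P := convexHull_min hBP hconv hz
  by_cases h : z ∈ ⋃ S ∈ {S | S ∈ T ∧ S.card = 4}, convexHull ℝ (S : Set (Fin 3 → ℝ))
  · right
    rw [← inter_iUnion₂]
    exact ⟨hz, h⟩
  · exact Or.inl ⟨hzP, h⟩

end Triangulation

/-- An affine certificate `ℓ` with linear part `v ↦ -⟨v, a⟩`. -/
lemma exists_affine_eq_sub_dotp (ℓ : (Fin 3 → ℝ) →ᵃ[ℝ] ℝ) :
    ∃ (a : Fin 3 → ℝ) (c : ℝ), ∀ v, ℓ v = c - dotp v a := by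
  obtain ⟨d, hd⟩ := exists_eq_dotpLin (-ℓ.linear)
  refine ⟨d, ℓ 0, fun v => ?_⟩
  have h := congrFun ℓ.decomp v
  simp only [Pi.add_apply] at h
  rw [← dotpLin_apply, ← hd, LinearMap.neg_apply, h]
  ring

/-- An affine function dominated by another one on `S` and dominating it on `B` agrees with it on
`conv B ∩ conv S`. -/
lemma eqOn_convexHull_inter {f g : (Fin 3 → ℝ) →ᵃ[ℝ] ℝ} {B S : Set (Fin 3 → ℝ)}
    (hB : ∀ v ∈ B, g v ≤ f v) (hS : ∀ v ∈ S, f v ≤ g v) :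
    EqOn f g (convexHull ℝ B ∩ convexHull ℝ S) := by
  have key : ∀ (h : (Fin 3 → ℝ) →ᵃ[ℝ] ℝ) (s : Set (Fin 3 → ℝ)), (∀ v ∈ s, 0 ≤ h v) →
      ∀ z ∈ convexHull ℝ s, 0 ≤ h z := fun h s hs z hz =>
    convexHull_min (t := h ⁻¹' Ici 0) hs ((convex_Ici 0).affine_preimage h) hz
  rintro z ⟨hzB, hzS⟩
  have h1 := key (f - g) B (fun v hv => by simpa using hB v hv) z hzB
  have h2 := key (g - f) S (fun v hv => by simpa using hS v hv) z hzS
  simp only [AffineMap.coe_sub, Pi.sub_apply, sub_nonneg] at h1 h2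
  exact le_antisymm h2 h1

theorem stmt10 (P : Set (Fin 3 → ℝ)) (p : Fin 3 → ℝ) (hP : IsCanonicalPoly P p)
    (T : Set (Finset (Fin 3 → ℝ))) (hT : IsTriangulationOf P T)
    (hfine : IsFine P T) (hcent : IsCentral p T) (huni : IsUnimodular T)
    (w : (Fin 3 → ℝ) → ℝ) (hw : Induces P T w) :
    ∃ φ : Finset (Fin 3 → ℝ) → (Fin 3 → ℝ),
      (∀ S ∈ T, S.card = 4 →
        p ∈ S ∧
        (∀ v ∈ S, w p + dotp p (φ S) = w v + dotp v (φ S)) ∧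
        (∀ x : Fin 3 → ℝ, (∀ v ∈ S, w p + dotp p x = w v + dotp v x) → x = φ S) ∧
        {q | q ∈ P ∩ latticePts ∧ w q + dotp q (φ S) = w p + dotp p (φ S)} =
          (S : Set (Fin 3 → ℝ))) ∧
      Set.BijOn φ {S | S ∈ T ∧ S.card = 4}
        (Set.extremePoints ℝ (tropRegion (P ∩ latticePts) w p)) ∧
      volume P * 6 =
        ((Set.extremePoints ℝ (tropRegion (P ∩ latticePts) w p)).ncard : ENNReal) := by
  set A := P ∩ latticePts with hA
  obtain ⟨⟨F, -, -, hPF⟩, hpL, hpint⟩ := hP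
  have hconv : Convex ℝ P := hPF ▸ convex_convexHull ℝ F
  have hpP : p ∈ P := interior_subset (hpint.ge rfl).1
  have hpA : p ∈ A := ⟨hpP, hpL⟩
  have hAfin : A.Finite := by
    refine (hT.1.biUnion fun S _ => S.finite_toSet).subset fun v hv => ?_
    obtain ⟨S, hS, hvS⟩ := hfine v hv
    exact mem_biUnion hS hvS
  have hpS : ∀ S ∈ T, S.card = 4 → p ∈ S := by
    intro S hS hc
    obtain ⟨S', hS', hpS'⟩ := hfine p hpA
    have hp1 : {p} ∈ T := hT.2.2.2.1 S' hS' {p} (by simpa using hpS')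
    obtain ⟨F', -, hFS, hFp, hEq⟩ := hT.2.2.2.2 S hS {p} hp1
    have hpF : p ∈ convexHull ℝ (F' : Set (Fin 3 → ℝ)) := by
      rw [← hEq]
      exact ⟨hcent S hS hc, by simp⟩
    obtain ⟨v, hv⟩ := convexHull_nonempty_iff.1 ⟨p, hpF⟩
    have := Finset.mem_singleton.1 (hFp hv)
    exact hFS (this ▸ hv)
  have hcert : ∀ S : Finset (Fin 3 → ℝ), ∃ a : Fin 3 → ℝ, S ∈ T → S.card = 4 → ∃ c : ℝ,
      (∀ v ∈ S, w v + dotp v a = c) ∧ ∀ v ∈ A, v ∉ S → c < w v + dotp v a := by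
    intro S
    by_cases h : S ∈ T ∧ S.card = 4
    · obtain ⟨ℓ, h1, h2⟩ := hw S h.1 h.2
      obtain ⟨a, c, hac⟩ := exists_affine_eq_sub_dotp ℓ
      refine ⟨a, fun _ _ => ⟨c, fun v hv => ?_, fun v hv hvS => ?_⟩⟩
      · linarith [h1 v hv, hac v]
      · linarith [h2 v hv hvS, hac v]
    · exact ⟨0, fun h1 h2 => (h ⟨h1, h2⟩).elim⟩
  choose φ hφ' using hcert
  have heq : ∀ S ∈ T, S.card = 4 → ∀ v ∈ S, w p + dotp p (φ S) = w v + dotp v (φ S) := by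
    intro S hS hc v hv
    obtain ⟨c, h1, -⟩ := hφ' S hS hc
    rw [h1 v hv, h1 p (hpS S hS hc)]
  have hlt : ∀ S ∈ T, S.card = 4 → ∀ v ∈ A, v ∉ S →
      w p + dotp p (φ S) < w v + dotp v (φ S) := by
    intro S hS hc v hv hvS
    obtain ⟨c, h1, h2⟩ := hφ' S hS hc
    rw [h1 p (hpS S hS hc)]
    exact h2 v hv hvS
  have huniq : ∀ S ∈ T, S.card = 4 → ∀ x : Fin 3 → ℝ,
      (∀ v ∈ S, w p + dotp p x = w v + dotp v x) → x = φ S := by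
    intro S hS hc x hx
    refine eq_of_dotp_sub_eq ((affineSpan_eq_top_iff_card (hT.2.1 S hS).2).2 hc)
      (c := dotp p x - dotp p (φ S)) fun v hv => ?_
    linarith [hx v hv, heq S hS hc v hv]
  have hset : ∀ S ∈ T, S.card = 4 →
      {q | q ∈ A ∧ w q + dotp q (φ S) = w p + dotp p (φ S)} = (S : Set (Fin 3 → ℝ)) := by
    intro S hS hc
    ext q
    refine ⟨fun hq => ?_, fun hq => ⟨(hT.2.1 S hS).1 hq, (heq S hS hc q hq).symm⟩⟩
    by_contra hqS
    exact (hlt S hS hc q hq.1 hqS).ne hq.2.symm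
  have hmem : ∀ S ∈ T, S.card = 4 → φ S ∈ tropRegion A w p := by
    intro S hS hc v hv
    by_cases hvS : v ∈ S
    · exact (heq S hS hc v hvS).le
    · exact (hlt S hS hc v hv hvS).le
  have hbij : BijOn φ {S | S ∈ T ∧ S.card = 4} (extremePoints ℝ (tropRegion A w p)) := by
    refine ⟨?_, ?_, ?_⟩
    · rintro S ⟨hS, hc⟩
      refine ⟨hmem S hS hc, fun x hx y hy ⟨a, b, ha, hb, hab, hxy⟩ => huniq S hS hc x ?_⟩
      intro v hv
      have hvA : v ∈ A := (hT.2.1 S hS).1 hv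
      have h := heq S hS hc v hv
      rw [← hxy, dotp_convex_comb, dotp_convex_comb] at h
      refine le_antisymm (hx v hvA) ?_
      by_contra! hcon
      obtain rfl : b = 1 - a := by linarith
      nlinarith [mul_lt_mul_of_pos_left hcon ha, mul_le_mul_of_nonneg_left (hy v hvA) hb.le]
    · rintro S ⟨hS, hc⟩ S' ⟨hS', hc'⟩ h
      have h1 := hset S hS hc
      rw [h, hset S' hS' hc'] at h1
      exact (Finset.coe_injective h1).symm
    · intro x hx
      obtain ⟨S, hS, hc, hspan⟩ := hT.exists_affineSpan_inter_eq_top hconv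
        (fun v hv => hv.1.1) (affineSpan_tight_eq_top hAfin hpA hx)
      refine ⟨S, ⟨hS, hc⟩, (?_ : x = φ S).symm⟩
      let g : (Fin 3 → ℝ) → (Fin 3 → ℝ) →ᵃ[ℝ] ℝ := fun y =>
        AffineMap.const ℝ _ (w p + dotp p y) - (dotpLin y).toAffineMap
      have hg : ∀ y v, g y v = w p + dotp p y - dotp v y := fun y v => by
        simp [g, dotpLin_apply]
      have hfg : g x = g (φ S) := AffineMap.ext_on hspan <| eqOn_convexHull_inter
        (fun v hv => by
          rw [hg, hg]
          linarith [hv.2, hmem S hS hc v hv.1])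
        (fun v hv => by
          rw [hg, hg]
          linarith [hx.1 v ((hT.2.1 S hS).1 hv), heq S hS hc v hv])
      refine huniq S hS hc x fun v hv => ?_
      have := DFunLike.congr_fun hfg v
      rw [hg, hg] at this
      linarith [heq S hS hc v hv]
  refine ⟨φ, fun S hS hc => ⟨hpS S hS hc, heq S hS hc, huniq S hS hc, hset S hS hc⟩, hbij, ?_⟩
  rw [hT.volume_eq huni, ← hbij.image_eq, hbij.injOn.ncard_image]
end
end
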